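/- arXiv:1603.02890 — 4 statements merged into one kernel-verified Lean document; each statement's English description precedes it below -/
import Mathlib

section
/- Let q be an odd prime power. For each d ≥ 1, let π_q(d;χ₂,−1) denote the number of monic irreducible polynomials P ∈ 𝔽_q[T] of degree d whose constant term P(0) is a non-square in 𝔽_q^×. Then for every positive integer n, ∑_{d | n, 2d ∤ n} d · π_q(d;χ₂,−1) = (qⁿ − 1)/2. -/
open Polynomial

/-- The norm of `-x` is a power of the constant coefficient of the minimal polynomial of `x`. -/
theorem Algebra.norm_neg_eq_minpoly_coeff_zero_pow {K L : Type*} [Field K] [Field L] [Algebra K L]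
    [FiniteDimensional K L] (x : L) :
    Algebra.norm K (-x) =
      (minpoly K x).coeff 0 ^ (Module.finrank K L / (minpoly K x).natDegree) := by
  have hx : IsIntegral K x := _root_.IsIntegral.of_finite K x
  have hd : (minpoly K x).natDegree * Module.finrank (IntermediateField.adjoin K {x}) L =
      Module.finrank K L := by
    rw [← IntermediateField.adjoin.finrank hx, Module.finrank_mul_finrank]
  have hgen : Algebra.norm K (IntermediateField.AdjoinSimple.gen K x) =
      (-1) ^ (minpoly K x).natDegree * (minpoly K x).coeff 0 := by
    have h := Algebra.PowerBasis.norm_gen_eq_coeff_zero_minpoly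
      (IntermediateField.adjoin.powerBasis hx)
    rwa [IntermediateField.adjoin.powerBasis_gen, IntermediateField.minpoly_gen,
      IntermediateField.adjoin.powerBasis_dim] at h
  have hneg : -x = algebraMap K L (-1) * x := by simp
  rw [hneg, map_mul, Algebra.norm_algebraMap, Algebra.norm_eq_norm_adjoin, hgen, mul_pow,
    ← pow_mul, hd, ← mul_assoc, ← mul_pow, ← hd,
    Nat.mul_div_cancel_left _ (minpoly.natDegree_pos hx)]
  simp

namespace FiniteField

/-- In an extension of finite fields, an element is a square iff its norm is. -/
theorem isSquare_norm_iff {K L : Type*} [Field K] [Field L] [Algebra K L] [Finite L] {x : L} :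
    IsSquare (Algebra.norm K x) ↔ IsSquare x := by
  have := Finite.of_injective _ (algebraMap K L).injective
  have := Fintype.ofFinite K
  have := Fintype.ofFinite L
  have : FiniteDimensional K L := Module.Finite.of_finite
  by_cases hK : ringChar K = 2
  · have hL : ringChar L = 2 := by rw [← Algebra.ringChar_eq K L, hK]
    exact iff_of_true (isSquare_of_char_two hK _) (isSquare_of_char_two hL _)
  have hL : ringChar L ≠ 2 := by rwa [← Algebra.ringChar_eq K L]
  rcases eq_or_ne x 0 with rfl | hx
  · simp
  rw [isSquare_iff hK (Algebra.norm_ne_zero_iff.mpr hx), isSquare_iff hL hx,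
    ← (algebraMap K L).injective.eq_iff, map_pow, algebraMap_norm_eq_pow, map_one, ← pow_mul]
  have hdvd : Fintype.card K - 1 ∣ Fintype.card L - 1 := by
    rw [Module.card_eq_pow_finrank (K := K) (V := L)]
    simpa using Nat.sub_dvd_pow_sub_pow (Fintype.card K) 1 (Module.finrank K L)
  have hoK : Fintype.card K % 2 = 1 := odd_card_of_char_ne_two hK
  have hoL : Fintype.card L % 2 = 1 := odd_card_of_char_ne_two hL
  obtain ⟨m, hm⟩ := hdvd
  have hexp : (Nat.card L - 1) / (Nat.card K - 1) * (Fintype.card K / 2) = Fintype.card L / 2 := by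
    rw [Nat.card_eq_fintype_card, Nat.card_eq_fintype_card, hm,
      Nat.mul_div_cancel_left _ (Nat.sub_pos_of_lt Fintype.one_lt_card)]
    have h1 : Fintype.card K - 1 = 2 * (Fintype.card K / 2) := by omega
    have h2 : Fintype.card L - 1 = 2 * (Fintype.card L / 2) := by omega
    rw [h1, h2] at hm
    nlinarith
  rw [hexp]

/-- A finite field of odd cardinality `q` has `(q - 1) / 2` non-squares. -/
theorem two_mul_card_nonsquare_add_one {K : Type*} [Field K] [Fintype K] [DecidableEq K]
    (hK : ringChar K ≠ 2) :
    2 * (Finset.univ.filter fun x : K => ¬ IsSquare x).card + 1 = Fintype.card K := by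
  have hsum := quadraticChar_sum_zero hK
  have hx : ∀ x : K, quadraticChar K x =
      1 - (if x = 0 then 1 else 0) - 2 * (if ¬ IsSquare x then 1 else 0) := by
    intro x
    rcases eq_or_ne x 0 with rfl | h0
    · simp
    by_cases hs : IsSquare x
    · simp [(quadraticChar_one_iff_isSquare h0).mpr hs, h0, hs]
    · simp [quadraticChar_neg_one_iff_not_isSquare.mpr hs, h0, hs]
  simp_rw [hx] at hsum
  rw [Finset.sum_sub_distrib, Finset.sum_sub_distrib, ← Finset.mul_sum, Finset.sum_boole,
    Finset.sum_boole, Finset.filter_eq' Finset.univ (0 : K), if_pos (Finset.mem_univ _),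
    Finset.card_singleton, Finset.sum_const, Finset.card_univ, nsmul_one] at hsum
  zify
  push_cast at hsum
  linarith

/-- The roots in `L` of the irreducible polynomials over `K` of a degree dividing `[L : K]` and
with a given property are counted by degree. -/
theorem card_filter_minpoly {K L : Type*} [Field K] [Field L] [Algebra K L] [Fintype L]
    {d : ℕ} (hd : d ∣ Module.finrank K L) (p : K[X] → Prop) [DecidablePred p] :
    (Finset.univ.filter fun x : L => (minpoly K x).natDegree = d ∧ p (minpoly K x)).card =
      d * Nat.card {P : K[X] // P.Monic ∧ Irreducible P ∧ P.natDegree = d ∧ p P} := by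
  classical
  have := Finite.of_injective _ (algebraMap K L).injective
  have : FiniteDimensional K L := Module.Finite.of_finite
  set s := Finset.univ.filter fun x : L => (minpoly K x).natDegree = d ∧ p (minpoly K x) with hs
  have hmin : ∀ {P : K[X]}, P.Monic → Irreducible P → ∀ x : L, aeval x P = 0 ↔ minpoly K x = P :=
    fun hm hi x => ⟨fun h => (minpoly.eq_of_irreducible_of_monic hi h hm).symm,
      fun h => h ▸ minpoly.aeval K x⟩
  have hroots : ∀ P : K[X], P.Monic → Irreducible P → P.natDegree = d →
      (Finset.univ.filter fun x : L => minpoly K x = P).card = d := by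
    intro P hm hi hP
    have hsplit : (P.map (algebraMap K L)).Splits := by
      have hdvd := hi.natDegree_dvd_iff_dvd_X_pow_card_pow_sub_X.mp (hP ▸ hd)
      rw [← Module.natCard_eq_pow_finrank] at hdvd
      have := FiniteField.isSplittingField_sub L K
      rw [← Nat.card_eq_fintype_card] at this
      exact Splits.of_dvd (IsSplittingField.splits L (X ^ Nat.card L - X : K[X]))
        (map_ne_zero (X_pow_card_sub_X_ne_zero K Finite.one_lt_card))
        (map_dvd (algebraMap K L) hdvd)
    have hcard := card_rootSet_eq_natDegree (PerfectField.separable_of_irreducible hi) hsplit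
    rw [← hP, ← hcard, ← Nat.card_eq_fintype_card]
    refine (Nat.subtype_card _ fun x => ?_).symm
    simp [mem_rootSet, hm.ne_zero, hmin hm hi]
  have hcard : Nat.card {P : K[X] // P.Monic ∧ Irreducible P ∧ P.natDegree = d ∧ p P} =
      (s.image (minpoly K)).card := by
    refine Nat.subtype_card _ fun P => ?_
    simp only [Finset.mem_image, hs, Finset.mem_filter, Finset.mem_univ, true_and]
    constructor
    · rintro ⟨x, ⟨hx, hp⟩, rfl⟩
      have hint : IsIntegral K x := IsIntegral.of_finite K x
      exact ⟨minpoly.monic hint, minpoly.irreducible hint, hx, hp⟩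
    · rintro ⟨hm, hi, hP, hp⟩
      have hpos : 0 < (Finset.univ.filter fun x : L => minpoly K x = P).card := by
        rw [hroots P hm hi hP, ← hP]
        exact hi.natDegree_pos
      obtain ⟨x, hx⟩ := Finset.card_pos.mp hpos
      obtain rfl : minpoly K x = P := by simpa using hx
      exact ⟨x, ⟨hP, hp⟩, rfl⟩
  rw [hcard, Finset.card_eq_sum_card_image (minpoly K) s, mul_comm, ← smul_eq_mul]
  refine Finset.sum_const_nat fun P hP => ?_
  obtain ⟨x, hx, rfl⟩ := Finset.mem_image.mp hP
  simp only [hs, Finset.mem_filter, Finset.mem_univ, true_and] at hx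
  have hint : IsIntegral K x := IsIntegral.of_finite K x
  rw [← hroots _ (minpoly.monic hint) (minpoly.irreducible hint) hx.1]
  congr 1
  ext y
  simp only [hs, Finset.mem_filter, Finset.mem_univ, true_and, and_iff_right_iff_imp]
  intro h
  rwa [h]

/-- The weighted count of irreducible polynomials with non-square constant coefficient, in terms
of the degree of an extension of finite fields. -/
theorem two_mul_sum_mul_card_nonsquare_coeff_zero_add_one {F L : Type*} [Field F] [Fintype F]
    [Field L] [Fintype L] [Algebra F L] (hodd : Odd (Fintype.card F)) {n : ℕ}
    (hn : 0 < n) (hrank : Module.finrank F L = n) :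
    2 * ∑ d ∈ n.divisors.filter (fun d => ¬ (2 * d ∣ n)),
        d * Nat.card {P : F[X] // P.Monic ∧ Irreducible P ∧
          P.natDegree = d ∧ ¬ IsSquare (P.coeff 0)} + 1 = Fintype.card F ^ n := by
  classical
  have : FiniteDimensional F L := Module.Finite.of_finite
  have hF : ringChar F ≠ 2 := fun h => by
    have := FiniteField.even_card_of_char_two h
    rw [Nat.odd_iff] at hodd
    omega
  have hL : ringChar L ≠ 2 := by rwa [← Algebra.ringChar_eq F L]
  have hcard := FiniteField.two_mul_card_nonsquare_add_one hL
  rw [Module.card_eq_pow_finrank (K := F) (V := L), hrank] at hcard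
  have hdvd : ∀ x : L, (minpoly F x).natDegree ∣ n := fun x =>
    hrank ▸ minpoly.degree_dvd (IsIntegral.of_finite F x)
  have hsq : ∀ x : L, ¬ IsSquare (-x) ↔
      ¬ 2 * (minpoly F x).natDegree ∣ n ∧ ¬ IsSquare ((minpoly F x).coeff 0) := by
    intro x
    have hpos : 0 < (minpoly F x).natDegree := minpoly.natDegree_pos (IsIntegral.of_finite F x)
    have hdiv : 2 * (minpoly F x).natDegree ∣ n ↔ Even (n / (minpoly F x).natDegree) := by
      rw [even_iff_two_dvd, Nat.dvd_div_iff_mul_dvd (hdvd x), mul_comm]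
    rw [← FiniteField.isSquare_norm_iff (K := F), Algebra.norm_neg_eq_minpoly_coeff_zero_pow,
      hrank, hdiv, ← not_or, not_iff_not]
    constructor
    · intro h
      refine or_iff_not_imp_left.mpr fun ho => ?_
      rw [Nat.not_even_iff_odd] at ho
      obtain ⟨k, hk⟩ := ho
      rw [hk, pow_succ] at h
      rcases eq_or_ne ((minpoly F x).coeff 0) 0 with h0 | h0
      · simp [h0]
      have hk2 : IsSquare ((minpoly F x).coeff 0 ^ (2 * k)) := (even_two_mul k).isSquare_pow _
      have := h.div hk2
      rwa [mul_div_cancel_left₀ _ (pow_ne_zero _ h0)] at this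
    · rintro (h | h)
      · exact h.isSquare_pow _
      · exact h.pow _
  have hneg : (Finset.univ.filter fun x : L => ¬ IsSquare (-x)).card =
      (Finset.univ.filter fun x : L => ¬ IsSquare x).card :=
    Finset.card_equiv (Equiv.neg L) (by simp)
  have hsum : (Finset.univ.filter fun x : L => ¬ IsSquare (-x)).card =
      ∑ d ∈ n.divisors.filter (fun d => ¬ (2 * d ∣ n)),
        d * Nat.card {P : Polynomial F // P.Monic ∧ Irreducible P ∧
          P.natDegree = d ∧ ¬ IsSquare (P.coeff 0)} := by
    rw [Finset.card_eq_sum_card_fiberwise (f := fun x : L => (minpoly F x).natDegree)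
      (t := n.divisors.filter (fun d => ¬ (2 * d ∣ n)))]
    · refine Finset.sum_congr rfl fun d hd => ?_
      rw [Finset.mem_filter, Nat.mem_divisors] at hd
      rw [← FiniteField.card_filter_minpoly (L := L) (hrank.symm ▸ hd.1.1)
        (fun P => ¬ IsSquare (P.coeff 0)), Finset.filter_filter]
      congr 1
      ext x
      simp only [Finset.mem_filter, Finset.mem_univ, true_and, hsq]
      constructor
      · rintro ⟨⟨-, h⟩, rfl⟩
        exact ⟨rfl, h⟩
      · rintro ⟨rfl, h⟩
        exact ⟨⟨hd.2, h⟩, rfl⟩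
    · intro x hx
      simp only [Finset.coe_filter, Finset.mem_univ, true_and, Set.mem_ofPred_eq, hsq] at hx
      simp only [Finset.coe_filter, Set.mem_ofPred_eq, Nat.mem_divisors]
      exact ⟨⟨hdvd x, hn.ne'⟩, hx.1⟩
  rwa [← hneg, hsum] at hcard

end FiniteField

/-- For an odd prime power `q` (a finite field `F` of odd cardinality `q`) and every `n ≥ 1`:
`∑_{d ∣ n, 2d ∤ n} d · π_q(d; χ₂, −1) = (qⁿ − 1)/2`, where `π_q(d; χ₂, −1)` counts monic
irreducible polynomials of degree `d` whose constant term is a non-square in `𝔽_q^×`. -/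
theorem sum_nonsquare_primes (F : Type) [Field F] [Fintype F]
    (hodd : Odd (Fintype.card F)) (n : ℕ) (hn : 0 < n) :
    ∑ d ∈ n.divisors.filter (fun d => ¬ (2 * d ∣ n)),
        (d : ℚ) * (Nat.card {P : Polynomial F // P.Monic ∧ Irreducible P ∧
          P.natDegree = d ∧ ¬ IsSquare (P.coeff 0)} : ℚ) =
      ((Fintype.card F : ℚ) ^ n - 1) / 2 := by
  obtain ⟨p, hp⟩ := CharP.exists F
  have : Fact p.Prime := ⟨CharP.char_is_prime F p⟩
  have : NeZero n := ⟨hn.ne'⟩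
  let L := FiniteField.Extension F p n
  have : Fintype L := Fintype.ofFinite L
  have hcard := FiniteField.two_mul_sum_mul_card_nonsquare_coeff_zero_add_one (L := L) hodd hn
    (FiniteField.finrank_extension F p n)
  have hq := congrArg (Nat.cast : ℕ → ℚ) hcard
  push_cast at hq
  linarith
end

section
/- Let q be an odd prime power. Define g(n) = π_q(n;χ₂,{0,1}) + π_q(n/2;χ₂,−1) if n is even and g(n) = π_q(n;χ₂,{0,1}) if n is odd. Then for every positive integer n, ∑_{d | n} d · g(d) = (qⁿ + 1)/2 + ∑_{i=1}^{v₂(n)} (q^{n/2^i} − 1)/2, where v₂(n) is the 2-adic valuation of n. -/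
open Polynomial

section Extension

variable {F K : Type*} [Field F] [Fintype F] [Field K] [Fintype K] [Algebra F K]

/-- A monic irreducible polynomial whose degree divides the degree of `K / F` is the minimal
polynomial of exactly as many elements of `K` as its degree. -/
theorem card_minpoly_eq {P : F[X]} (hm : P.Monic) (hi : Irreducible P)
    (hd : P.natDegree ∣ Module.finrank F K) :
    Nat.card {a : K // minpoly F a = P} = P.natDegree := by
  have hdvd := hi.natDegree_dvd_iff_dvd_X_pow_card_pow_sub_X.1 hd
  have hcard : Nat.card F ^ Module.finrank F K = Nat.card K :=
    (Module.natCard_eq_pow_finrank (K := F) (V := K)).symm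
  have hs : (P.map (algebraMap F K)).Splits := by
    have hK : (X ^ Nat.card K - X : K[X]).Splits := by
      obtain ⟨p, hp⟩ := CharP.exists K
      have : Fact p.Prime := ⟨CharP.char_is_prime K p⟩
      let := ZMod.algebra K p
      simpa using FiniteField.splits_X_pow_card_sub_X (K := K) p
    exact hK.of_dvd (FiniteField.X_pow_card_sub_X_ne_zero K Finite.one_lt_card)
      (by simpa only [hcard, Polynomial.map_sub, Polynomial.map_pow, map_X] using
        Polynomial.map_dvd (algebraMap F K) hdvd)
  have hr : P.rootSet K = {a : K | minpoly F a = P} := by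
    ext a
    rw [mem_rootSet_of_ne hm.ne_zero, Set.mem_ofPred_eq]
    constructor
    · intro h
      exact (minpoly.eq_of_irreducible_of_monic hi h hm).symm
    · rintro rfl
      exact minpoly.aeval F a
  rw [← card_rootSet_eq_natDegree (PerfectField.separable_of_irreducible hi) hs,
    ← Nat.card_eq_fintype_card, hr]
  rfl

theorem sum_divisors_mul_card_irreducible (p : F[X] → Prop) :
    ∑ d ∈ (Module.finrank F K).divisors,
        d * Nat.card {P : F[X] // P.Monic ∧ Irreducible P ∧ P.natDegree = d ∧ p P} =
      Nat.card {a : K // p (minpoly F a)} := by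
  have hfin : ∀ d : (Module.finrank F K).divisors,
      Finite {P : F[X] // P.Monic ∧ Irreducible P ∧ P.natDegree = (d : ℕ) ∧ p P} := by
    rintro ⟨d, hd⟩
    refine ((Set.finite_range (minpoly F (B := K))).subset ?_).to_subtype
    rintro P ⟨hm, hi, rfl, -⟩
    have h := card_minpoly_eq (K := K) hm hi (Nat.dvd_of_mem_divisors hd)
    have hne : Nat.card {a : K // minpoly F a = P} ≠ 0 := h ▸ hi.natDegree_pos.ne'
    obtain ⟨⟨a, ha⟩⟩ := (Nat.card_ne_zero.1 hne).1
    exact ⟨a, ha⟩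
  have hpos : Module.finrank F K ≠ 0 := Module.finrank_pos.ne'
  let e : {a : K // p (minpoly F a)} ≃
      Σ d : (Module.finrank F K).divisors,
        Σ P : {P : F[X] // P.Monic ∧ Irreducible P ∧ P.natDegree = (d : ℕ) ∧ p P},
          {a : K // minpoly F a = P} :=
    { toFun := fun a ↦ ⟨⟨(minpoly F a.1).natDegree, Nat.mem_divisors.2
          ⟨minpoly.degree_dvd (IsIntegral.of_finite F a.1), hpos⟩⟩,
        ⟨minpoly F a.1, minpoly.monic (IsIntegral.of_finite F a.1),
          minpoly.irreducible (IsIntegral.of_finite F a.1), rfl, a.2⟩, ⟨a.1, rfl⟩⟩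
      invFun := fun x ↦ ⟨x.2.2.1, x.2.2.2.symm ▸ x.2.1.2.2.2.2⟩
      left_inv := fun _ ↦ rfl
      right_inv := by
        rintro ⟨⟨d, hd⟩, ⟨P, hP⟩, ⟨a, ha⟩⟩
        dsimp only at ha
        subst ha
        have hdeg : (minpoly F a).natDegree = d := hP.2.2.1
        subst hdeg
        rfl }
  have hfib : ∀ d : (Module.finrank F K).divisors,
      Nat.card (Σ P : {P : F[X] // P.Monic ∧ Irreducible P ∧ P.natDegree = (d : ℕ) ∧ p P},
          {a : K // minpoly F a = P}) =
        d * Nat.card {P : F[X] // P.Monic ∧ Irreducible P ∧ P.natDegree = (d : ℕ) ∧ p P} := by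
    intro d
    have := hfin d
    have := Fintype.ofFinite
      {P : F[X] // P.Monic ∧ Irreducible P ∧ P.natDegree = (d : ℕ) ∧ p P}
    rw [Nat.card_sigma, Finset.sum_congr rfl (g := fun _ ↦ (d : ℕ))]
    · simp [mul_comm]
    · rintro ⟨P, hm, hi, hP, -⟩ -
      exact (card_minpoly_eq hm hi (hP ▸ Nat.dvd_of_mem_divisors d.2)).trans hP
  rw [Nat.card_congr e, Nat.card_sigma, Finset.sum_congr rfl fun d _ ↦ hfib d]
  exact (Finset.sum_coe_sort (Module.finrank F K).divisors fun d ↦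
    d * Nat.card {P : F[X] // P.Monic ∧ Irreducible P ∧ P.natDegree = d ∧ p P}).symm

omit [Fintype F] in
theorem norm_neg_eq_coeff_zero_minpoly_pow (a : K) :
    Algebra.norm F (-a) =
      (minpoly F a).coeff 0 ^ (Module.finrank F K / (minpoly F a).natDegree) := by
  have ha : IsIntegral F a := IsIntegral.of_finite F a
  have hdeg := IntermediateField.adjoin.finrank ha
  have htower := Module.finrank_mul_finrank F (IntermediateField.adjoin F {a}) K
  have hgen := Algebra.PowerBasis.norm_gen_eq_coeff_zero_minpoly
    (IntermediateField.adjoin.powerBasis ha)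
  rw [IntermediateField.adjoin.powerBasis_gen, IntermediateField.adjoin.powerBasis_dim,
    IntermediateField.minpoly_gen] at hgen
  have hquot : Module.finrank F K / (minpoly F a).natDegree =
      Module.finrank (IntermediateField.adjoin F {a}) K := by
    rw [← htower, hdeg, Nat.mul_div_cancel_left _ (minpoly.natDegree_pos ha)]
  have hneg : Algebra.norm F (-1 : K) = (-1) ^ Module.finrank F K := by
    have := Algebra.norm_algebraMap (S := K) (-1 : F)
    simpa using this
  rw [neg_eq_neg_one_mul, map_mul, hneg, Algebra.norm_eq_norm_adjoin, hgen, hquot, ← htower, hdeg,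
    pow_mul, ← mul_pow, ← mul_assoc, ← mul_pow]
  simp

theorem two_mul_card_not_isSquare_norm (hodd : Odd (Fintype.card F)) :
    2 * (Nat.card {a : K // ¬ IsSquare (Algebra.norm F a)} : ℤ) = Fintype.card K - 1 := by
  classical
  have hchar : ringChar F ≠ 2 := by
    intro h
    have := FiniteField.even_card_iff_char_two.1 h
    have := Nat.odd_iff.1 hodd
    omega
  have hsum : ∑ a : K, quadraticChar F (Algebra.norm F a) = 0 := by
    obtain ⟨u, hu⟩ := quadraticChar_exists_neg_one hchar
    obtain ⟨b, rfl⟩ := FiniteField.norm_surjective F K u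
    have hb : b ≠ 0 := by
      rintro rfl
      simp at hu
    have h := (mulLeft_bijective₀ b hb).sum_comp fun a ↦ quadraticChar F (Algebra.norm F a)
    simp only [map_mul, hu, ← Finset.mul_sum] at h
    linarith
  have hpt : ∀ a : K, 2 * (if ¬ IsSquare (Algebra.norm F a) then (1 : ℤ) else 0) =
      1 - (if a = 0 then 1 else 0) - quadraticChar F (Algebra.norm F a) := by
    intro a
    by_cases ha : a = 0
    · simp [ha]
    · have hn : Algebra.norm F a ≠ 0 := Algebra.norm_ne_zero_iff.2 ha
      by_cases hs : IsSquare (Algebra.norm F a)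
      · simp [ha, hs, (quadraticChar_one_iff_isSquare hn).2 hs]
      · simp [ha, hs, quadraticChar_neg_one_iff_not_isSquare.2 hs]
  have := Finset.sum_congr rfl fun a (_ : a ∈ Finset.univ) ↦ hpt a
  rw [← Finset.mul_sum, Finset.sum_sub_distrib, Finset.sum_sub_distrib, hsum,
    Finset.sum_boole] at this
  rw [Nat.card_eq_fintype_card, Fintype.card_subtype]
  simpa using this

end Extension

theorem FiniteField.exists_extension_finrank_eq (F : Type*) [Field F] [Finite F] {n : ℕ}
    (hn : n ≠ 0) : ∃ (K : Type) (_ : Field K) (_ : Fintype K) (_ : Algebra F K),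
      Module.finrank F K = n := by
  obtain ⟨p, hp⟩ := CharP.exists F
  have : Fact p.Prime := ⟨CharP.char_is_prime F p⟩
  have : NeZero n := ⟨hn⟩
  exact ⟨FiniteField.Extension F p n, inferInstance, Fintype.ofFinite _, inferInstance,
    FiniteField.finrank_extension F p n⟩

section Divisors

variable {M : Type*} [AddCommMonoid M] (f : ℕ → M) {n : ℕ}

theorem Nat.sum_divisors_ite_even_div (hn : 0 < n) :
    ∑ d ∈ n.divisors, (if Even (n / d) then f d else 0) =
      if 2 ∣ n then ∑ d ∈ (n / 2).divisors, f d else 0 := by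
  rw [← Finset.sum_filter]
  split_ifs with h
  · obtain ⟨m, rfl⟩ := h
    congr 1
    ext d
    simp only [Finset.mem_filter, Nat.mem_divisors]
    constructor
    · rintro ⟨⟨⟨k, hk⟩, h0⟩, he⟩
      have hd : 0 < d := Nat.pos_of_ne_zero (by rintro rfl; simp at hk; omega)
      rw [hk, Nat.mul_div_cancel_left _ hd] at he
      obtain ⟨j, rfl⟩ := he
      have : m = d * j := by linarith [mul_add d j j]
      exact ⟨by simp [this], by omega⟩
    · rintro ⟨⟨k, hk⟩, h0⟩
      have hm : m = d * k := by omega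
      have hd : 0 < d := Nat.pos_of_ne_zero (by rintro rfl; simp at hm; omega)
      refine ⟨⟨hm ▸ ⟨2 * k, by ring⟩, by omega⟩, ?_⟩
      rw [hm, show 2 * (d * k) = d * (2 * k) by ring, Nat.mul_div_cancel_left _ hd]
      exact even_two_mul k
  · rw [Finset.filter_false_of_mem, Finset.sum_empty]
    intro d hd he
    exact h (he.two_dvd.trans (Nat.div_dvd_of_dvd (Nat.dvd_of_mem_divisors hd)))

theorem Nat.sum_divisors_ite_two_dvd (hn : 0 < n) :
    ∑ d ∈ n.divisors, (if 2 ∣ d then f (d / 2) else 0) =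
      if 2 ∣ n then ∑ d ∈ (n / 2).divisors, f d else 0 := by
  rw [← Finset.sum_filter]
  split_ifs with h
  · obtain ⟨m, rfl⟩ := h
    refine Finset.sum_nbij' (· / 2) (2 * ·) ?_ ?_ ?_ ?_ fun _ _ ↦ rfl
    · rintro d hd
      obtain ⟨⟨hd, h0⟩, k, rfl⟩ := by simpa using hd
      simpa using ⟨Nat.dvd_of_mul_dvd_mul_left two_pos hd, h0⟩
    · intro d hd
      obtain ⟨hd, h0⟩ := by simpa using hd
      simpa using ⟨Nat.mul_dvd_mul_left 2 hd, h0⟩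
    · intro d hd
      exact Nat.mul_div_cancel' (Finset.mem_filter.1 hd).2
    · intro d _
      simp
  · rw [Finset.filter_false_of_mem, Finset.sum_empty]
    exact fun d hd h2 ↦ h (h2.trans (Nat.dvd_of_mem_divisors hd))

theorem Nat.eq_sum_range_padicValNat_of_two_dvd_rec {B S : ℕ → M}
    (h : ∀ n, 0 < n → B n = S n + if 2 ∣ n then B (n / 2) else 0) (hn : 0 < n) :
    B n = ∑ i ∈ Finset.range (padicValNat 2 n + 1), S (n / 2 ^ i) := by
  induction n using Nat.strong_induction_on with
  | _ n ih =>
    rw [h n hn, Finset.sum_range_succ', add_comm]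
    split_ifs with h2
    · obtain ⟨m, rfl⟩ := h2
      have hm : 0 < m := by omega
      rw [Nat.mul_div_cancel_left _ two_pos, ih m (by omega) hm,
        padicValNat.mul two_ne_zero hm.ne', padicValNat.self one_lt_two, add_comm 1]
      simp [pow_succ', Nat.mul_div_mul_left]
    · simp [padicValNat.eq_zero_of_not_dvd h2]

end Divisors

section FiniteField

variable (F : Type*) [Field F] [Fintype F] {n : ℕ}

/-- The number of monic irreducible polynomials of degree `d` with non-square constant term. -/
noncomputable def cardIrreducibleNonsquare (d : ℕ) : ℕ :=
  Nat.card {P : F[X] // P.Monic ∧ Irreducible P ∧ P.natDegree = d ∧ ¬ IsSquare (P.coeff 0)}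

theorem sum_divisors_odd_div_mul_card (hodd : Odd (Fintype.card F)) (hn : 0 < n) :
    ∑ d ∈ n.divisors, (if Even (n / d) then 0 else (d : ℚ) * cardIrreducibleNonsquare F d) =
      ((Fintype.card F : ℚ) ^ n - 1) / 2 := by
  obtain ⟨K, _, _, _, rfl⟩ := FiniteField.exists_extension_finrank_eq F hn.ne'
  have hcount : Nat.card {a : K // ¬ IsSquare
      ((minpoly F a).coeff 0 ^ (Module.finrank F K / (minpoly F a).natDegree))} =
      Nat.card {a : K // ¬ IsSquare (Algebra.norm F a)} :=
    Nat.card_congr ((Equiv.neg K).subtypeEquiv fun a ↦ by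
      rw [Equiv.neg_apply, norm_neg_eq_coeff_zero_minpoly_pow])
  have hsum := sum_divisors_mul_card_irreducible (F := F) (K := K)
    fun P ↦ ¬ IsSquare (P.coeff 0 ^ (Module.finrank F K / P.natDegree))
  have hnorm := two_mul_card_not_isSquare_norm (K := K) hodd
  rw [← hcount, ← hsum, Module.card_eq_pow_finrank (K := F) (V := K)] at hnorm
  have hnorm' := congrArg (Int.cast : ℤ → ℚ) hnorm
  push_cast at hnorm'
  rw [eq_div_iff two_ne_zero, mul_comm, ← hnorm']
  congr 1
  refine Finset.sum_congr rfl fun d _ ↦ ?_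
  split_ifs with he
  · have : IsEmpty {P : F[X] // P.Monic ∧ Irreducible P ∧ P.natDegree = d ∧
        ¬ IsSquare (P.coeff 0 ^ (Module.finrank F K / P.natDegree))} :=
      ⟨fun ⟨P, _, _, hP, h⟩ ↦ h (hP ▸ he.isSquare_pow _)⟩
    simp
  · rw [cardIrreducibleNonsquare]
    congr 2
    refine Nat.card_congr (Equiv.subtypeEquivRight fun P ↦ ?_)
    refine and_congr_right fun _ ↦ and_congr_right fun _ ↦ and_congr_right fun hP ↦ not_congr ?_
    rw [hP]
    refine ⟨fun h ↦ h.pow _, fun h ↦ ?_⟩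
    obtain ⟨k, hk⟩ := Nat.not_even_iff_odd.1 he
    by_cases h0 : P.coeff 0 = 0
    · simp [h0]
    · rw [hk, pow_succ] at h
      have := h.div ((even_two_mul k).isSquare_pow (P.coeff 0))
      rwa [mul_div_cancel_left₀ _ (pow_ne_zero _ h0)] at this

theorem sum_divisors_mul_cardIrreducibleNonsquare (hodd : Odd (Fintype.card F)) (hn : 0 < n) :
    ∑ d ∈ n.divisors, (d : ℚ) * cardIrreducibleNonsquare F d =
      ((Fintype.card F : ℚ) ^ n - 1) / 2 +
        if 2 ∣ n then ∑ d ∈ (n / 2).divisors, (d : ℚ) * cardIrreducibleNonsquare F d else 0 := by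
  rw [← sum_divisors_odd_div_mul_card F hodd hn, ← Nat.sum_divisors_ite_even_div _ hn,
    ← Finset.sum_add_distrib]
  refine Finset.sum_congr rfl fun d _ ↦ ?_
  split_ifs <;> simp

theorem sum_divisors_mul_card_square_add_nonsquare (hn : 0 < n) :
    ∑ d ∈ n.divisors, (d : ℚ) * Nat.card {P : F[X] // P.Monic ∧ Irreducible P ∧
        P.natDegree = d ∧ IsSquare (P.coeff 0)} +
      ∑ d ∈ n.divisors, (d : ℚ) * cardIrreducibleNonsquare F d = (Fintype.card F : ℚ) ^ n := by
  obtain ⟨K, _, _, _, rfl⟩ := FiniteField.exists_extension_finrank_eq F hn.ne'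
  have h1 := sum_divisors_mul_card_irreducible (F := F) (K := K) fun P ↦ IsSquare (P.coeff 0)
  have h2 := sum_divisors_mul_card_irreducible (F := F) (K := K) fun P ↦ ¬ IsSquare (P.coeff 0)
  have h3 : Nat.card {a : K // IsSquare ((minpoly F a).coeff 0)} +
      Nat.card {a : K // ¬ IsSquare ((minpoly F a).coeff 0)} =
        Fintype.card F ^ Module.finrank F K := by
    classical
    rw [← Module.card_eq_pow_finrank (K := F) (V := K), ← Nat.card_sum,
      Nat.card_congr (Equiv.sumCompl _), Nat.card_eq_fintype_card]
  rw [← h1, ← h2] at h3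
  exact_mod_cast h3

end FiniteField


/-- For an odd prime power `q` (a finite field `F` of odd cardinality `q`), let
`g(d) = π_q(d;χ₂,{0,1}) + π_q(d/2;χ₂,−1)` for even `d` and `g(d) = π_q(d;χ₂,{0,1})` for odd `d`,
where `π_q(d;χ₂,{0,1})` counts monic irreducibles of degree `d` with square (possibly zero)
constant term, and `π_q(d;χ₂,−1)` those with non-square constant term. Then for every `n ≥ 1`,
`∑_{d ∣ n} d·g(d) = (qⁿ+1)/2 + ∑_{i=1}^{v₂(n)} (q^{n/2ⁱ} − 1)/2`. -/
theorem sum_g_divisors (F : Type) [Field F] [Fintype F]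
    (hodd : Odd (Fintype.card F)) (n : ℕ) (hn : 0 < n) :
    ∑ d ∈ n.divisors, (d : ℚ) *
        ((Nat.card {P : Polynomial F // P.Monic ∧ Irreducible P ∧
            P.natDegree = d ∧ IsSquare (P.coeff 0)} : ℚ) +
          if 2 ∣ d then
            (Nat.card {P : Polynomial F // P.Monic ∧ Irreducible P ∧
              P.natDegree = d / 2 ∧ ¬ IsSquare (P.coeff 0)} : ℚ)
          else 0) =
      ((Fintype.card F : ℚ) ^ n + 1) / 2 +
        ∑ i ∈ Finset.Icc 1 (padicValNat 2 n),
          ((Fintype.card F : ℚ) ^ (n / 2 ^ i) - 1) / 2 := by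
  have hB := sum_divisors_mul_cardIrreducibleNonsquare F hodd hn
  have hA := sum_divisors_mul_card_square_add_nonsquare F hn
  have hrec := Nat.eq_sum_range_padicValNat_of_two_dvd_rec
    (fun m hm ↦ sum_divisors_mul_cardIrreducibleNonsquare F hodd (n := m) hm) hn
  have hE := Nat.sum_divisors_ite_two_dvd
    (fun d ↦ 2 * ((d : ℚ) * cardIrreducibleNonsquare F d)) hn
  rw [← Finset.mul_sum, ← mul_ite_zero] at hE
  rw [Finset.range_eq_Ico, Finset.sum_eq_sum_Ico_succ_bot (Nat.succ_pos _), pow_zero,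
    Nat.div_one, zero_add, Nat.succ_eq_add_one] at hrec
  have hsplit : ∀ d ∈ n.divisors, (d : ℚ) *
        ((Nat.card {P : F[X] // P.Monic ∧ Irreducible P ∧
            P.natDegree = d ∧ IsSquare (P.coeff 0)} : ℚ) +
          if 2 ∣ d then
            (Nat.card {P : F[X] // P.Monic ∧ Irreducible P ∧
              P.natDegree = d / 2 ∧ ¬ IsSquare (P.coeff 0)} : ℚ)
          else 0) =
      (d : ℚ) * Nat.card {P : F[X] // P.Monic ∧ Irreducible P ∧
          P.natDegree = d ∧ IsSquare (P.coeff 0)} +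
        if 2 ∣ d then 2 * (((d / 2 : ℕ) : ℚ) * cardIrreducibleNonsquare F (d / 2)) else 0 := by
    intro d _
    rw [mul_add]
    congr 1
    split_ifs with h
    · rw [cardIrreducibleNonsquare, ← mul_assoc]
      congr 1
      exact_mod_cast (Nat.mul_div_cancel' h).symm
    · simp
  rw [Finset.sum_congr rfl hsplit, Finset.sum_add_distrib, hE,
    ← Finset.Ico_add_one_right_eq_Icc]
  linarith
end

section
/- For every odd prime power q, K_q = ∏_{k≥0} (1 + q^{−2^k})^{1/2^{k+1}} / (1 − q^{1−2^{k+1}})^{1/2^{k+2}}, where the infinite product on the right converges. -/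
section Algebraic

open Polynomial Module

theorem two_mul_card_not_isSquare (E : Type*) [Field E] [Finite E] (h2 : ringChar E ≠ 2) :
    2 * Nat.card {x : E // ¬ IsSquare x} + 1 = Nat.card E := by
  classical
  have := Fintype.ofFinite E
  have key : ∀ a : E, (2 * (if ¬ IsSquare a then 1 else 0) : ℤ) =
      1 - quadraticChar E a - if a = 0 then 1 else 0 := by
    intro a
    by_cases ha : a = 0
    · simp [ha]
    by_cases hs : IsSquare a
    · simp [ha, hs, (quadraticChar_one_iff_isSquare ha).2 hs]
    · simp [ha, hs, quadraticChar_neg_one_iff_not_isSquare.2 hs]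
  have hsum := Finset.sum_congr rfl fun a (_ : a ∈ Finset.univ) => key a
  rw [← Finset.mul_sum, Finset.sum_sub_distrib, Finset.sum_sub_distrib,
    quadraticChar_sum_zero h2, Finset.sum_boole] at hsum
  simp only [Finset.sum_const, Finset.card_univ, Finset.sum_ite_eq', Finset.mem_univ,
    if_true] at hsum
  rw [Nat.card_eq_fintype_card, Nat.card_eq_fintype_card, Fintype.card_subtype]
  simp at hsum
  omega

section Norm

variable {K L : Type*} [Field K] [Field L] [Algebra K L]

theorem isSquare_norm_iff [Finite L] (h2 : ringChar K ≠ 2) (x : L) :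
    IsSquare (Algebra.norm K x) ↔ IsSquare x := by
  have := Finite.of_injective _ (algebraMap K L).injective
  have := Fintype.ofFinite K
  have := Fintype.ofFinite L
  have h2' : ringChar L ≠ 2 := by rwa [← Algebra.ringChar_eq K L]
  by_cases hx : x = 0
  · simp [hx]
  have hN : Algebra.norm K x ≠ 0 := Algebra.norm_ne_zero_iff.2 hx
  rw [FiniteField.isSquare_iff h2 hN, FiniteField.isSquare_iff h2' hx,
    ← (algebraMap K L).injective.eq_iff, map_pow, FiniteField.algebraMap_norm_eq_pow, map_one,
    ← pow_mul]
  suffices (Nat.card L - 1) / (Nat.card K - 1) * (Fintype.card K / 2) = Fintype.card L / 2 by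
    rw [this]
  rw [Nat.card_eq_fintype_card, Nat.card_eq_fintype_card]
  have hK := FiniteField.odd_card_of_char_ne_two h2
  have hL := FiniteField.odd_card_of_char_ne_two h2'
  have hdvd : Fintype.card K - 1 ∣ Fintype.card L - 1 := by
    rw [Module.card_eq_pow_finrank (K := K) (V := L)]
    exact Nat.sub_one_dvd_pow_sub_one _ _
  obtain ⟨k, hk⟩ := hdvd
  have h1 : 1 < Fintype.card K := Fintype.one_lt_card
  rw [hk, Nat.mul_div_cancel_left _ (by omega)]
  have : Fintype.card K - 1 = 2 * (Fintype.card K / 2) := by omega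
  rw [this, mul_assoc] at hk
  rw [mul_comm k]
  omega

theorem norm_neg_eq_coeff_zero_minpoly_pow_s17 [FiniteDimensional K L] (x : L) :
    Algebra.norm K (-x) = (minpoly K x).coeff 0 ^ finrank (IntermediateField.adjoin K {x}) L := by
  have hx : IsIntegral K x := .of_finite K x
  have h1 : Algebra.norm K (-1 : L) = (-1) ^ finrank K L := by
    simpa using Algebra.norm_algebraMap (S := L) (-1 : K)
  rw [← neg_one_mul, map_mul, h1, Algebra.norm_eq_norm_adjoin K x,
    ← IntermediateField.adjoin.powerBasis_gen hx, Algebra.PowerBasis.norm_gen_eq_coeff_zero_minpoly,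
    IntermediateField.adjoin.powerBasis_gen hx, IntermediateField.minpoly_gen,
    ← finrank_mul_finrank K (IntermediateField.adjoin K {x}) L,
    (IntermediateField.adjoin.powerBasis hx).finrank, pow_mul, ← mul_pow, ← mul_assoc, ← mul_pow]
  simp

theorem not_isSquare_neg_iff [Finite L] (h2 : ringChar K ≠ 2) (x : L) :
    ¬ IsSquare (-x) ↔ ¬ IsSquare ((minpoly K x).coeff 0) ∧
      ∃ j, (minpoly K x).natDegree * (2 * j + 1) = finrank K L := by
  have : FiniteDimensional K L := .of_finite
  have hx : IsIntegral K x := .of_finite K x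
  have hd : 0 < (minpoly K x).natDegree := minpoly.natDegree_pos hx
  have := Finite.of_injective _ (algebraMap K L).injective
  rw [← isSquare_norm_iff h2, norm_neg_eq_coeff_zero_minpoly_pow_s17,
    ← finrank_mul_finrank K (IntermediateField.adjoin K {x}) L,
    IntermediateField.adjoin.finrank hx]
  obtain ⟨m, hm | hm⟩ := Nat.even_or_odd' (finrank (IntermediateField.adjoin K {x}) L)
  · rw [hm]
    refine iff_of_false (fun h => h ⟨(minpoly K x).coeff 0 ^ m, by ring⟩) ?_
    rintro ⟨-, j, hj⟩
    have := Nat.eq_of_mul_eq_mul_left hd hj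
    omega
  · rw [hm]
    constructor
    · exact fun h => ⟨fun hs => h (hs.pow _), m, rfl⟩
    · rintro ⟨h, -⟩ ⟨r, hr⟩
      have h0 : (minpoly K x).coeff 0 ≠ 0 := by
        rintro h0
        exact h (h0 ▸ IsSquare.zero)
      refine h ⟨r / (minpoly K x).coeff 0 ^ m, ?_⟩
      rw [div_mul_div_comm, ← hr, eq_div_iff (by positivity)]
      ring

end Norm

/-- The monic irreducible polynomials over `F` whose constant term is not a square. -/
abbrev NonsquarePrime (F : Type*) [Field F] : Type _ :=
  {P : Polynomial F // P.Monic ∧ Irreducible P ∧ ¬ IsSquare (P.coeff 0)}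

section Count

variable {F : Type*} [Field F]

/-- The pairs `(P, j)` with `P` of degree `n / (2 * j + 1)`. -/
abbrev NonsquarePrime.Fiber (F : Type*) [Field F] (n : ℕ) : Type _ :=
  {x : NonsquarePrime F × ℕ // x.1.1.natDegree * (2 * x.2 + 1) = n}

/-- An element of `L` whose negative is not a square is a root of exactly one nonsquare prime. -/
theorem bijective_root_of_fiber {L : Type*} [Field L] [Algebra F L] [Finite L]
    (h2 : ringChar F ≠ 2) {n : ℕ} (hn : finrank F L = n)
    (f : (Σ x : NonsquarePrime.Fiber F n, x.1.1.1.rootSet L) → {a : L // ¬ IsSquare (-a)})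
    (hf : ∀ x, (f x : L) = x.2) : Function.Bijective f := by
  have minpoly_eq : ∀ x : (Σ x : NonsquarePrime.Fiber F n, x.1.1.1.rootSet L),
      x.1.1.1.1 = minpoly F (x.2 : L) := by
    rintro ⟨⟨⟨⟨P, hP⟩, j⟩, hx⟩, a, ha⟩
    exact minpoly.eq_of_irreducible_of_monic hP.2.1 (aeval_eq_zero_of_mem_rootSet ha) hP.1
  constructor
  · intro x y hxy
    have hr : (x.2 : L) = y.2 := by rw [← hf, ← hf, hxy]
    have hP : x.1.1.1.1 = y.1.1.1.1 := 
      (minpoly_eq x).trans (hr ▸ (minpoly_eq y).symm)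
    obtain ⟨⟨⟨⟨P, hP1⟩, i⟩, hx⟩, a, ha⟩ := x
    obtain ⟨⟨⟨⟨Q, hQ1⟩, j⟩, hy⟩, b, hb⟩ := y
    dsimp only at hr hP hx hy
    subst hr hP
    obtain rfl : i = j := by
      have := Nat.eq_of_mul_eq_mul_left hP1.2.1.natDegree_pos (hx.trans hy.symm)
      omega
    rfl
  · rintro ⟨a, ha⟩
    have hai : IsIntegral F a := .of_finite F a
    obtain ⟨h, j, hj⟩ := (not_isSquare_neg_iff h2 a).1 ha
    refine ⟨⟨⟨⟨⟨minpoly F a, minpoly.monic hai, minpoly.irreducible hai, h⟩, j⟩, hj.trans hn⟩,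
      a, ?_⟩, Subtype.ext (hf _)⟩
    rw [mem_rootSet]
    exact ⟨minpoly.ne_zero hai, minpoly.aeval F a⟩

theorem Polynomial.card_rootSet_of_natDegree_dvd_finrank {L : Type*} [Field L] [Algebra F L]
    [Finite L] {P : F[X]} (hP : Irreducible P) (hd : P.natDegree ∣ finrank F L) :
    Nat.card (P.rootSet L) = P.natDegree := by
  have := Finite.of_injective _ (algebraMap F L).injective
  have := Fintype.ofFinite L
  have : FiniteDimensional F L := .of_finite
  rw [Nat.card_eq_fintype_card]
  refine card_rootSet_eq_natDegree (PerfectField.separable_of_irreducible hP) ?_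
  have hdvd := hP.natDegree_dvd_iff_dvd_X_pow_card_pow_sub_X.1 hd
  have hcard : Nat.card F ^ finrank F L = Fintype.card L := by
    have := Fintype.ofFinite F
    rw [Nat.card_eq_fintype_card, ← Module.card_eq_pow_finrank]
  rw [hcard] at hdvd
  have hs := (FiniteField.isSplittingField_sub L F).splits
  refine hs.of_dvd (map_ne_zero (FiniteField.X_pow_card_sub_X_ne_zero F Fintype.one_lt_card))
    ?_
  simpa only [coe_mapRingHom] using _root_.map_dvd (mapRingHom (algebraMap F L)) hdvd

variable [Finite F]

theorem finite_fiber_and_two_mul_sum_natDegree (h2 : ringChar F ≠ 2) {n : ℕ} (hn : n ≠ 0) :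
    ∃ _ : Fintype (NonsquarePrime.Fiber F n),
      2 * ∑ x : NonsquarePrime.Fiber F n, x.1.1.1.natDegree + 1 = Nat.card F ^ n := by
  obtain ⟨p, hp⟩ := CharP.exists F
  have : Fact p.Prime := ⟨CharP.char_is_prime F p⟩
  have : NeZero n := ⟨hn⟩
  let L := FiniteField.Extension F p n
  have hL : finrank F L = n := FiniteField.finrank_extension F p n
  have h2L : ringChar L ≠ 2 := by rwa [← Algebra.ringChar_eq F L]
  have hroot : ∀ x : NonsquarePrime.Fiber F n, ∀ a : x.1.1.1.rootSet L, ¬ IsSquare (-(a : L)) := by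
    rintro ⟨⟨⟨P, hP⟩, j⟩, hx⟩ ⟨a, ha⟩
    have := minpoly.eq_of_irreducible_of_monic hP.2.1 (aeval_eq_zero_of_mem_rootSet ha) hP.1
    exact (not_isSquare_neg_iff h2 a).2 (this ▸ ⟨hP.2.2, j, hx.trans hL.symm⟩)
  have hcard : ∀ x : NonsquarePrime.Fiber F n,
      Nat.card (x.1.1.1.rootSet L) = x.1.1.1.natDegree := fun x =>
    card_rootSet_of_natDegree_dvd_finrank x.1.1.2.2.1 (Dvd.intro _ (x.2.trans hL.symm))
  let e := Equiv.ofBijective _ (bijective_root_of_fiber h2 hL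
    (fun x => ⟨x.2, hroot x.1 x.2⟩) fun _ => rfl)
  have hne : ∀ x : NonsquarePrime.Fiber F n, Nonempty (x.1.1.1.rootSet L) := fun x =>
    (Nat.card_pos_iff.1 ((hcard x).symm ▸ x.1.1.2.2.1.natDegree_pos)).1
  have hfin : Finite (Σ x : NonsquarePrime.Fiber F n, x.1.1.1.rootSet L) := .of_equiv _ e.symm
  have hfin' : Finite (NonsquarePrime.Fiber F n) :=
    .of_surjective (Sigma.fst : (Σ x : NonsquarePrime.Fiber F n, x.1.1.1.rootSet L) → _)
      fun x => ⟨⟨x, (hne x).some⟩, rfl⟩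
  have hneg : Nat.card {a : L // ¬ IsSquare (-a)} = Nat.card {a : L // ¬ IsSquare a} :=
    Nat.card_congr ((Equiv.neg L).subtypeEquiv fun _ => Iff.rfl)
  have := Fintype.ofFinite (NonsquarePrime.Fiber F n)
  refine ⟨this, ?_⟩
  rw [← FiniteField.natCard_extension F p n, ← two_mul_card_not_isSquare L h2L, ← hneg,
    ← Nat.card_congr e, Nat.card_sigma]
  simp_rw [hcard]

end Count

end Algebraic

section Analytic

open Real Filter Topology

variable {ι : Type*} {d : ι → ℕ} {q : ℕ} {u : ℝ}

theorem hasSum_pow_sub_one_mul_pow_div {q u : ℝ} (hq : 1 ≤ q) (hu : 0 ≤ u) (hqu : q * u < 1) :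
    HasSum (fun n : ℕ => (q ^ n - 1) * u ^ n / n) (log (1 - u) - log (1 - q * u)) := by
  have hu1 : u < 1 := lt_of_le_of_lt (le_mul_of_one_le_left hu hq) hqu
  have h1 := hasSum_pow_div_log_of_abs_lt_one (x := u) (by rwa [abs_of_nonneg hu])
  have h2 := hasSum_pow_div_log_of_abs_lt_one (x := q * u) (by rwa [abs_of_nonneg (by positivity)])
  rw [← hasSum_nat_add_iff' 1]
  convert h2.sub h1 using 1
  · ext n
    push_cast
    ring
  · simp
    ring

theorem hasSum_of_hasSum_fiber {α β : Type*} {g : α → ℝ} (hg : ∀ x, 0 ≤ g x) (ν : α → β)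
    {s : β → ℝ} {a : ℝ} (hfib : ∀ n, HasSum (fun x : {x : α // ν x = n} => g x) (s n))
    (htot : HasSum s a) : HasSum g a := by
  rw [← (Equiv.sigmaFiberEquiv ν).hasSum_iff]
  refine htot.sigma_of_hasSum hfib ((summable_sigma_of_nonneg fun _ => hg _).2
    ⟨fun n => (hfib n).summable, htot.summable.congr fun n => ((hfib n).tsum_eq).symm⟩)

theorem hasSum_fiber_pow_div (hd : ∀ i, d i ≠ 0)
    (hcount : ∀ n ≠ 0, ∃ _ : Fintype {x : ι × ℕ // d x.1 * (2 * x.2 + 1) = n},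
      2 * ∑ x : {x : ι × ℕ // d x.1 * (2 * x.2 + 1) = n}, d x.1.1 + 1 = q ^ n) (u : ℝ) (n : ℕ) :
    HasSum (fun x : {x : ι × ℕ // d x.1 * (2 * x.2 + 1) = n} =>
        (2 : ℝ) * (1 / (2 * x.1.2 + 1)) * (u ^ d x.1.1) ^ (2 * x.1.2 + 1))
      ((q ^ n - 1) * u ^ n / n) := by
  by_cases hn : n = 0
  · subst hn
    have : IsEmpty {x : ι × ℕ // d x.1 * (2 * x.2 + 1) = 0} := ⟨fun x => by simpa [hd] using x.2⟩
    simp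
  · obtain ⟨_, hsum⟩ := hcount n hn
    have hterm : ∀ x : {x : ι × ℕ // d x.1 * (2 * x.2 + 1) = n},
        (2 : ℝ) * (1 / (2 * x.1.2 + 1)) * (u ^ d x.1.1) ^ (2 * x.1.2 + 1) =
          2 * u ^ n / n * d x.1.1 := by
      rintro ⟨⟨i, j⟩, rfl⟩
      have : (d i : ℝ) ≠ 0 := by exact_mod_cast hd i
      simp only [← pow_mul]
      push_cast
      field_simp
    have hsum' : (q : ℝ) ^ n - 1 =
        2 * ∑ x : {x : ι × ℕ // d x.1 * (2 * x.2 + 1) = n}, (d x.1.1 : ℝ) := by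
      rw [sub_eq_iff_eq_add]
      exact_mod_cast hsum.symm
    simp_rw [hterm]
    convert (hasSum_fintype _) using 1
    rw [← Finset.mul_sum, hsum']
    ring

/-- The generating series identity `∑ᵢ log ((1 + u ^ dᵢ) / (1 - u ^ dᵢ)) = log ((1 - u) / (1 - q u))`
when the total weight of the pairs `(i, j)` with `dᵢ (2 j + 1) = n` is `(q ^ n - 1) / 2`. -/
theorem hasSum_log_sub_log_pow (hd : ∀ i, d i ≠ 0) (hq : 1 ≤ q)
    (hcount : ∀ n ≠ 0, ∃ _ : Fintype {x : ι × ℕ // d x.1 * (2 * x.2 + 1) = n},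
      2 * ∑ x : {x : ι × ℕ // d x.1 * (2 * x.2 + 1) = n}, d x.1.1 + 1 = q ^ n)
    (hu : 0 ≤ u) (hqu : q * u < 1) :
    HasSum (fun i => log (1 + u ^ d i) - log (1 - u ^ d i)) (log (1 - u) - log (1 - q * u)) := by
  have hq' : (1 : ℝ) ≤ q := by exact_mod_cast hq
  have hu1 : u < 1 := lt_of_le_of_lt (le_mul_of_one_le_left hu hq') hqu
  have hT := hasSum_of_hasSum_fiber
    (g := fun x : ι × ℕ => (2 : ℝ) * (1 / (2 * x.2 + 1)) * (u ^ d x.1) ^ (2 * x.2 + 1))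
    (fun x => by positivity) (fun x => d x.1 * (2 * x.2 + 1))
    (hasSum_fiber_pow_div hd hcount u) (hasSum_pow_sub_one_mul_pow_div hq' hu hqu)
  have hrow : ∀ i, HasSum (fun j : ℕ => (2 : ℝ) * (1 / (2 * j + 1)) * (u ^ d i) ^ (2 * j + 1))
      (log (1 + u ^ d i) - log (1 - u ^ d i)) := by
    intro i
    apply hasSum_log_sub_log_of_abs_lt_one
    rw [abs_of_nonneg (by positivity)]
    exact pow_lt_one₀ hu hu1 (hd i)
  exact hT.prod_fiberwise hrow

theorem neg_log_one_sub_nonneg {x : ℝ} (h0 : 0 ≤ x) (h1 : x < 1) : 0 ≤ -log (1 - x) :=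
  neg_nonneg.2 (log_nonpos (by linarith) (by linarith))

theorem neg_log_one_sub_mono {x y : ℝ} (hxy : x ≤ y) (h1 : y < 1) :
    -log (1 - x) ≤ -log (1 - y) :=
  neg_le_neg (log_le_log (by linarith) (by linarith))

theorem log_one_add_eq {x : ℝ} (h0 : 0 ≤ x) (h1 : x < 1) :
    log (1 + x) = log (1 - x ^ 2) - log (1 - x) := by
  rw [show 1 - x ^ 2 = (1 + x) * (1 - x) by ring, log_mul (by linarith) (by linarith)]
  ring

/-- Iterating `2 B(u) - B(u²) = c(u)` for a nonnegative monotone `B`. -/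
theorem hasSum_of_two_mul_sub_eq {B c : ℝ → ℝ} {r : ℝ}
    (hB : ∀ u, 0 ≤ u → u < r → 0 ≤ B u)
    (hmono : ∀ u v, 0 ≤ u → u ≤ v → v < r → B u ≤ B v) (hc : ∀ u, 0 ≤ u → u < r → 0 ≤ c u)
    (h : ∀ u, 0 ≤ u → u < r → 2 * B u - B (u ^ 2) = c u) (hr : r ≤ 1) (hu : 0 ≤ u) (hur : u < r) :
    HasSum (fun k : ℕ => c (u ^ 2 ^ k) / 2 ^ (k + 1)) (B u) := by
  have hle : ∀ k : ℕ, u ^ 2 ^ k ≤ u := fun k =>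
    pow_le_of_le_one hu (by linarith) (by positivity)
  have h0 : ∀ k : ℕ, 0 ≤ u ^ 2 ^ k := fun k => by positivity
  have hlt : ∀ k : ℕ, u ^ 2 ^ k < r := fun k => (hle k).trans_lt hur
  rw [hasSum_iff_tendsto_nat_of_nonneg fun k => div_nonneg (hc _ (h0 k) (hlt k)) (by positivity)]
  have hpart : ∀ K : ℕ, ∑ k ∈ Finset.range K, c (u ^ 2 ^ k) / 2 ^ (k + 1) =
      B u - B (u ^ 2 ^ K) / 2 ^ K := by
    intro K
    induction K with
    | zero => simp
    | succ K ih =>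
      rw [Finset.sum_range_succ, ih, ← h _ (h0 K) (hlt K), ← pow_mul, ← pow_succ]
      field_simp
      ring
  have hlim : Tendsto (fun K : ℕ => B (u ^ 2 ^ K) / 2 ^ K) atTop (𝓝 0) := by
    refine squeeze_zero (fun K => div_nonneg (hB _ (h0 K) (hlt K)) (by positivity))
      (fun K => div_le_div_of_nonneg_right (hmono _ _ (h0 K) (hle K) hur) (by positivity)) ?_
    exact tendsto_const_nhds.div_atTop (tendsto_pow_atTop_atTop_of_one_lt one_lt_two)
  simpa [hpart] using tendsto_const_nhds.sub hlim

theorem hasSum_two_mul_neg_log_pow_two_pow {v : ℝ} (hv : 0 ≤ v) (hv1 : v < 1) :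
    HasSum (fun k : ℕ => (2 * -log (1 - v ^ 2 ^ k) - -log (1 - v ^ 2 ^ (k + 1))) / 2 ^ (k + 1))
      (-log (1 - v)) := by
  have := hasSum_of_two_mul_sub_eq (B := fun u => -log (1 - u))
    (c := fun u => 2 * -log (1 - u) - -log (1 - u ^ 2)) (r := 1)
    (fun _ => neg_log_one_sub_nonneg) (fun _ _ _ => neg_log_one_sub_mono)
    (fun u h0 h1 => ?_) (fun _ _ _ => rfl) le_rfl hv hv1
  · simpa only [← pow_mul, ← pow_succ] using this
  · have := log_one_add_eq h0 h1
    have := log_nonneg (x := 1 + u) (by linarith)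
    have := neg_log_one_sub_nonneg h0 h1
    linarith

theorem summable_neg_log_one_sub_pow (hd : ∀ i, d i ≠ 0) (hq : 1 ≤ q)
    (hcount : ∀ n ≠ 0, ∃ _ : Fintype {x : ι × ℕ // d x.1 * (2 * x.2 + 1) = n},
      2 * ∑ x : {x : ι × ℕ // d x.1 * (2 * x.2 + 1) = n}, d x.1.1 + 1 = q ^ n)
    (hu : 0 ≤ u) (hqu : q * u < 1) :
    Summable fun i => -log (1 - u ^ d i) := by
  have hq' : (1 : ℝ) ≤ q := by exact_mod_cast hq
  have hu1 : u < 1 := lt_of_le_of_lt (le_mul_of_one_le_left hu hq') hqu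
  refine .of_nonneg_of_le
    (fun i => neg_log_one_sub_nonneg (pow_nonneg hu _) (pow_lt_one₀ hu hu1 (hd i)))
    (fun i => ?_) (hasSum_log_sub_log_pow hd hq hcount hu hqu).summable
  have := log_nonneg (x := 1 + u ^ d i) (le_add_of_nonneg_right (pow_nonneg hu _))
  linarith

theorem two_mul_tsum_neg_log_sub (hd : ∀ i, d i ≠ 0) (hq : 1 ≤ q)
    (hcount : ∀ n ≠ 0, ∃ _ : Fintype {x : ι × ℕ // d x.1 * (2 * x.2 + 1) = n},
      2 * ∑ x : {x : ι × ℕ // d x.1 * (2 * x.2 + 1) = n}, d x.1.1 + 1 = q ^ n)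
    (hu : 0 ≤ u) (hqu : q * u < 1) :
    2 * ∑' i, -log (1 - u ^ d i) - ∑' i, -log (1 - (u ^ 2) ^ d i) =
      log (1 - u) - log (1 - q * u) := by
  have hq' : (1 : ℝ) ≤ q := by exact_mod_cast hq
  have hu1 : u < 1 := lt_of_le_of_lt (le_mul_of_one_le_left hu hq') hqu
  have hqu2 : q * u ^ 2 < 1 := by nlinarith
  have h1 := (summable_neg_log_one_sub_pow hd hq hcount hu hqu).hasSum
  have h2 := (summable_neg_log_one_sub_pow hd hq hcount (sq_nonneg u) hqu2).hasSum
  refine ((h1.mul_left 2).sub h2).unique ?_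
  refine (hasSum_log_sub_log_pow hd hq hcount hu hqu).congr_fun fun i => ?_
  rw [log_one_add_eq (pow_nonneg hu _) (pow_lt_one₀ hu hu1 (hd i)), ← pow_mul, ← pow_mul,
    mul_comm 2 (d i)]
  ring

theorem hasSum_log_sub_log_pow_two_pow (hd : ∀ i, d i ≠ 0) (hq : 1 ≤ q)
    (hcount : ∀ n ≠ 0, ∃ _ : Fintype {x : ι × ℕ // d x.1 * (2 * x.2 + 1) = n},
      2 * ∑ x : {x : ι × ℕ // d x.1 * (2 * x.2 + 1) = n}, d x.1.1 + 1 = q ^ n)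
    (hu : 0 ≤ u) (hqu : q * u < 1) :
    HasSum (fun k : ℕ => (log (1 - u ^ 2 ^ k) - log (1 - q * u ^ 2 ^ k)) / 2 ^ (k + 1))
      (∑' i, -log (1 - u ^ d i)) := by
  have hq' : (1 : ℝ) ≤ q := by exact_mod_cast hq
  have hq0 : (0 : ℝ) < q := by linarith
  have hlt : ∀ w : ℝ, w < 1 / q → q * w < 1 := fun w hw => by rwa [lt_div_iff₀' hq0] at hw
  have hlt1 : ∀ w : ℝ, w < 1 / q → w < 1 := fun w hw =>
    hw.trans_le (by rwa [div_le_one hq0])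
  refine hasSum_of_two_mul_sub_eq (B := fun u => ∑' i, -log (1 - u ^ d i))
    (c := fun u => log (1 - u) - log (1 - q * u)) (r := 1 / q)
    (fun w h0 h1 => tsum_nonneg fun i => ?_) (fun w z h0 hwz h1 => ?_) (fun w h0 h1 => ?_)
    (fun w h0 h1 => two_mul_tsum_neg_log_sub hd hq hcount h0 (hlt w h1))
    (by rwa [div_le_one hq0]) hu (by rwa [lt_div_iff₀' hq0])
  · exact neg_log_one_sub_nonneg (pow_nonneg h0 _) (pow_lt_one₀ h0 (hlt1 w h1) (hd i))
  · refine (summable_neg_log_one_sub_pow hd hq hcount h0 (hlt w (hwz.trans_lt h1))).tsum_le_tsum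
      (fun i => neg_log_one_sub_mono (pow_le_pow_left₀ h0 hwz _)
        (pow_lt_one₀ (h0.trans hwz) (hlt1 z h1) (hd i)))
      (summable_neg_log_one_sub_pow hd hq hcount (h0.trans hwz) (hlt z h1))
  · have := neg_log_one_sub_mono (le_mul_of_one_le_left h0 hq') (hlt w h1)
    linarith

end Analytic

section Combine

open Real

theorem hasSum_log_factor {q : ℕ} (hq : 1 < q) {A : ℝ}
    (hA : HasSum (fun k : ℕ => (log (1 - ((q : ℝ)⁻¹ ^ 2) ^ 2 ^ k) -
      log (1 - q * ((q : ℝ)⁻¹ ^ 2) ^ 2 ^ k)) / 2 ^ (k + 1)) A) :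
    HasSum (fun k : ℕ => log ((1 + (q : ℝ) ^ (-(2 ^ k : ℤ))) ^ ((1 : ℝ) / 2 ^ (k + 1)) /
        (1 - (q : ℝ) ^ ((1 : ℤ) - 2 ^ (k + 1))) ^ ((1 : ℝ) / 2 ^ (k + 2))))
      (-log (1 - (q : ℝ)⁻¹) / 2 + A / 2) := by
  have hq0 : (0 : ℝ) < q := by positivity
  have hv : (0 : ℝ) ≤ (q : ℝ)⁻¹ := by positivity
  have hv1 : (q : ℝ)⁻¹ < 1 := inv_lt_one_of_one_lt₀ (by exact_mod_cast hq)
  refine (((hasSum_two_mul_neg_log_pow_two_pow hv hv1).div_const 2).add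
    (hA.div_const 2)).congr_fun fun k => ?_
  have hx : (q : ℝ) ^ (-(2 ^ k : ℤ)) = (q : ℝ)⁻¹ ^ 2 ^ k := by
    rw [zpow_neg, ← inv_zpow, ← zpow_natCast]
    simp
  have hw : ((q : ℝ)⁻¹ ^ 2) ^ 2 ^ k = (q : ℝ)⁻¹ ^ 2 ^ (k + 1) := by
    rw [← pow_mul, ← pow_succ']
  have hy : (q : ℝ) ^ ((1 : ℤ) - 2 ^ (k + 1)) = q * (q : ℝ)⁻¹ ^ 2 ^ (k + 1) := by
    rw [sub_eq_add_neg, zpow_add₀ hq0.ne', zpow_one, zpow_neg, ← inv_zpow, ← zpow_natCast]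
    simp
  have hz0 : 0 ≤ (q : ℝ)⁻¹ ^ 2 ^ k := by positivity
  have hz1 : (q : ℝ)⁻¹ ^ 2 ^ k < 1 := pow_lt_one₀ hv hv1 (by positivity)
  have hlt : q * (q : ℝ)⁻¹ ^ 2 ^ (k + 1) < 1 := by
    calc q * (q : ℝ)⁻¹ ^ 2 ^ (k + 1) ≤ q * (q : ℝ)⁻¹ ^ 2 := by
          refine mul_le_mul_of_nonneg_left ?_ hq0.le
          exact pow_le_pow_of_le_one hv hv1.le (Nat.le_self_pow (by omega) 2)
      _ = (q : ℝ)⁻¹ := by field_simp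
      _ < 1 := hv1
  rw [hx, hy, hw, log_div (rpow_pos_of_pos (by linarith) _).ne'
    (rpow_pos_of_pos (by linarith) _).ne', log_rpow (by linarith), log_rpow (by linarith),
    log_one_add_eq hz0 hz1, ← pow_mul, ← pow_succ]
  field_simp
  ring

end Combine

/-- Product expression for the constant `K_q`: for every finite field `F` of odd cardinality
`q`, with `K_q = (1−q⁻¹)^{−1/2} ∏_P (1−q^{−2 deg P})^{−1/2}` (the convergent product over monic
irreducibles `P` with non-square constant term), one has
`K_q = ∏_{k≥0} (1+q^{−2ᵏ})^{1/2^{k+1}} / (1−q^{1−2^{k+1}})^{1/2^{k+2}}`,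
and the product on the right converges. -/
theorem Kq_product_formula (F : Type) [Field F] [Fintype F]
    (hodd : Odd (Fintype.card F)) :
    Multipliable
      (fun P : {P : Polynomial F // P.Monic ∧ Irreducible P ∧ ¬ IsSquare (P.coeff 0)} =>
        ((1 : ℝ) - (Fintype.card F : ℝ) ^ (-2 * ((P : Polynomial F).natDegree : ℤ))) ^
          (-(1 : ℝ) / 2)) ∧
    Multipliable
      (fun k : ℕ =>
        ((1 : ℝ) + (Fintype.card F : ℝ) ^ (-(2 ^ k : ℤ))) ^ ((1 : ℝ) / 2 ^ (k + 1)) /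
          ((1 : ℝ) - (Fintype.card F : ℝ) ^ ((1 : ℤ) - 2 ^ (k + 1))) ^ ((1 : ℝ) / 2 ^ (k + 2))) ∧
    ((1 : ℝ) - (Fintype.card F : ℝ)⁻¹) ^ (-(1 : ℝ) / 2) *
        (∏' P : {P : Polynomial F // P.Monic ∧ Irreducible P ∧ ¬ IsSquare (P.coeff 0)},
          ((1 : ℝ) - (Fintype.card F : ℝ) ^ (-2 * ((P : Polynomial F).natDegree : ℤ))) ^
            (-(1 : ℝ) / 2)) =
      ∏' k : ℕ,
        ((1 : ℝ) + (Fintype.card F : ℝ) ^ (-(2 ^ k : ℤ))) ^ ((1 : ℝ) / 2 ^ (k + 1)) /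
          ((1 : ℝ) - (Fintype.card F : ℝ) ^ ((1 : ℤ) - 2 ^ (k + 1))) ^ ((1 : ℝ) / 2 ^ (k + 2)) := by
  have h2 : ringChar F ≠ 2 := by
    rw [Ne, FiniteField.even_card_iff_char_two]
    have := Nat.odd_iff.1 hodd
    omega
  have hq : 1 < Fintype.card F := Fintype.one_lt_card
  have hq0 : (0 : ℝ) < Fintype.card F := by positivity
  have hv1 : (Fintype.card F : ℝ)⁻¹ < 1 := inv_lt_one_of_one_lt₀ (by exact_mod_cast hq)
  have hqu : Fintype.card F * (Fintype.card F : ℝ)⁻¹ ^ 2 < 1 := by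
    rwa [sq, mul_inv_cancel_left₀ hq0.ne']
  have hd : ∀ P : NonsquarePrime F, P.1.natDegree ≠ 0 := fun P => P.2.2.1.natDegree_pos.ne'
  have hcount := fun n (hn : n ≠ 0) =>
    Nat.card_eq_fintype_card (α := F) ▸ finite_fiber_and_two_mul_sum_natDegree h2 hn
  have hu : 0 ≤ (Fintype.card F : ℝ)⁻¹ ^ 2 := by positivity
  have hL := summable_neg_log_one_sub_pow hd hq.le hcount hu hqu
  have hR := hasSum_log_factor hq (hasSum_log_sub_log_pow_two_pow hd hq.le hcount hu hqu)
  have hbase : ∀ P : NonsquarePrime F,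
      (Fintype.card F : ℝ) ^ (-2 * (P.1.natDegree : ℤ)) =
        ((Fintype.card F : ℝ)⁻¹ ^ 2) ^ P.1.natDegree := by
    intro P
    rw [neg_mul, zpow_neg, ← inv_zpow, ← pow_mul, ← zpow_natCast]
    simp
  have hpos : ∀ P : NonsquarePrime F,
      (0 : ℝ) < 1 - (Fintype.card F : ℝ) ^ (-2 * (P.1.natDegree : ℤ)) := by
    intro P
    rw [hbase, ← pow_mul, sub_pos]
    exact pow_lt_one₀ (by positivity) hv1 (mul_ne_zero two_ne_zero (hd P))
  have hPL := Real.hasProd_of_hasSum_log (fun P => Real.rpow_pos_of_pos (hpos P) (-(1 : ℝ) / 2))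
    ((hL.hasSum.div_const 2).congr_fun fun P => by
      rw [Real.log_rpow (hpos P), hbase]
      ring)
  have hPR := Real.hasProd_of_hasSum_log (fun k => ?_) hR
  · refine ⟨hPL.multipliable, hPR.multipliable, ?_⟩
    rw [hPL.tprod_eq, hPR.tprod_eq, Real.rpow_def_of_pos (sub_pos.2 hv1), ← Real.exp_add]
    congr 1
    ring
  · refine div_pos (Real.rpow_pos_of_pos (by positivity) _) (Real.rpow_pos_of_pos ?_ _)
    rw [sub_pos]
    refine zpow_lt_one_of_neg₀ (by exact_mod_cast hq) ?_
    have : (1 : ℤ) < 2 ^ (k + 1) := one_lt_pow₀ one_lt_two (by omega)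
    omega
end

section
/- For every natural number n ≥ 1 there exists a polynomial Pₙ ∈ ℚ[x] of degree exactly n such that B(n,q) = Pₙ(q) for every odd prime power q. -/
open Polynomial UniqueFactorizationMonoid

/-- A polynomial of the form `A² + T·B²`. -/
def IsNormForm {F : Type*} [Field F] (f : F[X]) : Prop :=
  ∃ A B : F[X], f = A ^ 2 + X * B ^ 2

namespace IsNormForm

variable {F : Type*} [Field F]

theorem mul {f g : F[X]} (hf : IsNormForm f) (hg : IsNormForm g) : IsNormForm (f * g) := by
  obtain ⟨A, B, rfl⟩ := hf
  obtain ⟨C, D, rfl⟩ := hg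
  exact ⟨A * C - X * B * D, A * D + B * C, by ring⟩

theorem sq (f : F[X]) : IsNormForm (f ^ 2) := ⟨f, 0, by ring⟩

theorem one : IsNormForm (1 : F[X]) := ⟨1, 0, by ring⟩

theorem pow {f : F[X]} (hf : IsNormForm f) (k : ℕ) : IsNormForm (f ^ k) := by
  induction k with
  | zero => simpa using one
  | succ k ih => rw [pow_succ]; exact ih.mul hf

theorem prod {s : Finset F[X]} {g : F[X] → F[X]} (h : ∀ P ∈ s, IsNormForm (g P)) :
    IsNormForm (∏ P ∈ s, g P) :=
  Finset.prod_induction g IsNormForm (fun _ _ => mul) one h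

theorem isSquare_eval_zero {f : F[X]} (hf : IsNormForm f) : IsSquare (f.eval 0) := by
  obtain ⟨A, B, rfl⟩ := hf
  exact ⟨A.eval 0, by simp; ring⟩

end IsNormForm

section Splitting

variable {F : Type*} [Field F]

theorem natDegree_comp_neg_X_sq (f : F[X]) : (f.comp (-X ^ 2)).natDegree = 2 * f.natDegree := by
  rw [natDegree_comp, natDegree_neg, natDegree_X_pow, mul_comm]

/-- The norm of a polynomial in `S`, where `S² = -T`, pulled back along `T ↦ -S²`. -/
theorem exists_norm (g : F[X]) :
    ∃ A B : F[X], g = A.comp (-X ^ 2) + X * B.comp (-X ^ 2) := by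
  induction g using Polynomial.induction_on' with
  | add p q hp hq =>
    obtain ⟨A, B, h⟩ := hp
    obtain ⟨C, D, h'⟩ := hq
    exact ⟨A + C, B + D, by rw [h, h']; simp; ring⟩
  | monomial n a =>
    obtain ⟨k, rfl | rfl⟩ := Nat.even_or_odd' n
    · refine ⟨C ((-1) ^ k * a) * X ^ k, 0, ?_⟩
      rw [← C_mul_X_pow_eq_monomial]
      simp only [mul_comp, C_comp, zero_comp, mul_zero, add_zero, C_mul, C_pow, C_neg, C_1,
        pow_comp, neg_comp, one_comp, X_comp]
      rw [neg_pow (X ^ 2 : F[X]), ← pow_mul]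
      have : ((-1 : F[X]) ^ k) * (-1) ^ k = 1 := by rw [← mul_pow]; simp
      linear_combination (-C a * X ^ (2 * k)) * this
    · refine ⟨0, C ((-1) ^ k * a) * X ^ k, ?_⟩
      rw [← C_mul_X_pow_eq_monomial]
      simp only [mul_comp, C_comp, zero_comp, zero_add, C_mul, C_pow, C_neg, C_1,
        pow_comp, neg_comp, one_comp, X_comp]
      rw [neg_pow (X ^ 2 : F[X]), ← pow_mul]
      have : ((-1 : F[X]) ^ k) * (-1) ^ k = 1 := by rw [← mul_pow]; simp
      linear_combination (-C a * X ^ (2 * k + 1)) * this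

theorem comp_neg_X_sq_injective :
    Function.Injective (fun f : F[X] => f.comp (-X ^ 2)) := by
  intro f g h
  have h0 : (f - g).comp (-X ^ 2) = 0 := by simpa [sub_eq_zero] using h
  have h1 := natDegree_comp_neg_X_sq (f - g)
  rw [h0, natDegree_zero] at h1
  obtain ⟨c, hc⟩ := natDegree_eq_zero.1 (by omega : (f - g).natDegree = 0)
  rw [← hc, C_comp] at h0
  rw [h0] at hc
  exact sub_eq_zero.1 hc.symm

/-- A polynomial over which `-T` becomes a square is a norm. -/
theorem IsNormForm.of_dvd {P C : F[X]} (hP : Irreducible P) (hm : P.Monic)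
    (hd : P ∣ C ^ 2 + X) (h2 : (2 : F) ≠ 0) : IsNormForm P := by
  have hpos : 0 < P.natDegree := hP.natDegree_pos
  set s : F[X] := -X ^ 2 with hs
  have hsneg : s.comp (-X) = s := by simp [hs]
  have hnot : ¬ Irreducible (P.comp s) := by
    intro hirr
    have hX : ¬ P.comp s ∣ X := by
      intro h
      have := natDegree_le_of_dvd h X_ne_zero
      rw [natDegree_comp_neg_X_sq, natDegree_X] at this
      omega
    have hX2 : ¬ P.comp s ∣ Polynomial.C 2 * X := by
      intro h
      exact hX ((IsUnit.dvd_mul_left (isUnit_C.2 (isUnit_iff_ne_zero.2 h2))).1 h)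
    have hmul : P.comp s ∣ (C.comp s - X) * (C.comp s + X) := by
      obtain ⟨Q, hQ⟩ := hd
      refine ⟨Q.comp s, ?_⟩
      rw [← mul_comp, ← hQ]
      simp [hs]
      ring
    have key : P.comp s ∣ C.comp s - X ↔ P.comp s ∣ C.comp s + X := by
      constructor
      · rintro ⟨Q, hQ⟩
        refine ⟨Q.comp (-X), ?_⟩
        have := congrArg (fun f => f.comp (-X : F[X])) hQ
        simpa [comp_assoc, hsneg] using this
      · rintro ⟨Q, hQ⟩
        refine ⟨Q.comp (-X), ?_⟩
        have := congrArg (fun f => f.comp (-X : F[X])) hQ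
        simpa [comp_assoc, hsneg, sub_eq_add_neg] using this
    have both : P.comp s ∣ C.comp s - X ∧ P.comp s ∣ C.comp s + X := by
      rcases hirr.prime.dvd_or_dvd hmul with h | h
      · exact ⟨h, key.1 h⟩
      · exact ⟨key.2 h, h⟩
    apply hX2
    have := dvd_sub both.2 both.1
    have e : C.comp s + X - (C.comp s - X) = Polynomial.C 2 * X := by
      rw [show (Polynomial.C (2 : F)) = 2 from rfl]; ring
    rwa [e] at this
  have hne : P.comp s ≠ 0 := by
    intro h
    have := natDegree_comp_neg_X_sq P
    rw [← hs, h, natDegree_zero] at this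
    omega
  have hnu : ¬ IsUnit (P.comp s) := by
    intro h
    have := natDegree_eq_zero_of_isUnit h
    rw [natDegree_comp_neg_X_sq] at this
    omega
  rw [irreducible_iff] at hnot
  push Not at hnot
  obtain ⟨g, h, hgh, hg, hh⟩ := hnot hnu
  obtain ⟨A, B, hAB⟩ := exists_norm g
  obtain ⟨A', B', hAB'⟩ := exists_norm h
  have hg0 : g ≠ 0 := fun h0 => hne (by rw [hgh, h0, zero_mul])
  have hh0 : h ≠ 0 := fun h0 => hne (by rw [hgh, h0, mul_zero])
  have norm_eq : ∀ {g A B : F[X]}, g = A.comp s + X * B.comp s →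
      (A ^ 2 + X * B ^ 2).comp s = g * g.comp (-X) := by
    intro g A B hg
    rw [hg]
    simp [comp_assoc, hsneg]
    simp [hs]
    ring
  have norm_deg : ∀ {g A B : F[X]}, g = A.comp s + X * B.comp s → g ≠ 0 →
      (A ^ 2 + X * B ^ 2).natDegree = g.natDegree := by
    intro g A B hg hg0
    have h1 := natDegree_comp_neg_X_sq (A ^ 2 + X * B ^ 2)
    rw [← hs, norm_eq hg, natDegree_mul hg0, natDegree_comp, natDegree_neg, natDegree_X] at h1
    · omega
    · intro h0
      have := congrArg (fun f => f.comp (-X : F[X])) h0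
      simp [comp_assoc] at this
      exact hg0 this
  have hprod : P * P = (A ^ 2 + X * B ^ 2) * (A' ^ 2 + X * B' ^ 2) := by
    apply comp_neg_X_sq_injective
    have := congrArg (fun f => f.comp (-X : F[X])) hgh
    simp only [comp_assoc, hsneg, mul_comp] at this
    simp only [mul_comp]
    rw [← hs, norm_eq hAB, norm_eq hAB']
    nth_rewrite 2 [this]
    rw [hgh]
    ring
  have hdg : 0 < g.natDegree := by
    rw [Nat.pos_iff_ne_zero]
    intro h0
    obtain ⟨c, rfl⟩ := natDegree_eq_zero.1 h0
    exact hg (isUnit_C.2 (isUnit_iff_ne_zero.2 (by rintro rfl; simp at hg0)))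
  have hdh : 0 < h.natDegree := by
    rw [Nat.pos_iff_ne_zero]
    intro h0
    obtain ⟨c, rfl⟩ := natDegree_eq_zero.1 h0
    exact hh (isUnit_C.2 (isUnit_iff_ne_zero.2 (by rintro rfl; simp at hh0)))
  have hN := norm_deg hAB hg0
  have hN' := norm_deg hAB' hh0
  set N := A ^ 2 + X * B ^ 2 with hNdef
  set N' := A' ^ 2 + X * B' ^ 2
  have hPN : P ∣ N := by
    by_contra hndvd
    have hcop : IsCoprime P N := (hP.coprime_iff_not_dvd).2 hndvd
    have h1 : N ∣ 1 := by
      have : N ∣ P * P := ⟨N', hprod⟩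
      exact (hcop.symm.mul_right hcop.symm).isUnit_of_dvd' dvd_rfl this |>.dvd
    have := natDegree_eq_zero_of_isUnit (isUnit_of_dvd_one h1)
    omega
  obtain ⟨Q, hQ⟩ := hPN
  have hP0 : P ≠ 0 := hP.ne_zero
  have hPQ : P = Q * N' := by
    have : P * P = P * (Q * N') := by rw [hprod, hQ]; ring
    exact mul_left_cancel₀ hP0 this
  have hQu : IsUnit Q := by
    rcases hP.isUnit_or_isUnit hPQ with h | h
    · exact h
    · have := natDegree_eq_zero_of_isUnit h
      omega
  obtain ⟨c, hc, rfl⟩ := Polynomial.isUnit_iff.1 hQu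
  have hc0 : c ≠ 0 := hc.ne_zero
  have hlead : N.leadingCoeff = c := by rw [hQ]; simp [hm.leadingCoeff]
  have hsq : IsSquare c := by
    rw [← hlead]
    rcases lt_trichotomy ((A ^ 2).degree) ((X * B ^ 2).degree) with hlt | heq | hlt
    · rw [hNdef, leadingCoeff_add_of_degree_lt hlt]
      exact ⟨B.leadingCoeff, by simp [leadingCoeff_mul]; ring⟩
    · exfalso
      have hA0 : A ≠ 0 := by
        rintro rfl
        have hB0 : B = 0 := by
          by_contra hB
          have : X * B ^ 2 ≠ 0 := mul_ne_zero X_ne_zero (pow_ne_zero _ hB)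
          apply this
          rw [← degree_eq_bot, ← heq]; simp
        rw [hB0] at hAB
        simp at hAB
        exact hg0 hAB
      have hB0 : B ≠ 0 := by
        rintro rfl
        have : A ^ 2 ≠ 0 := pow_ne_zero _ hA0
        apply this
        rw [← degree_eq_bot, heq]; simp
      have := natDegree_eq_of_degree_eq heq
      rw [natDegree_pow, natDegree_mul X_ne_zero (pow_ne_zero _ hB0), natDegree_X,
        natDegree_pow] at this
      omega
    · rw [hNdef, leadingCoeff_add_of_degree_lt' hlt]
      exact ⟨A.leadingCoeff, by simp; ring⟩
  obtain ⟨d, rfl⟩ := hsq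
  have hd0 : d ≠ 0 := by rintro rfl; simp at hc0
  refine ⟨Polynomial.C d⁻¹ * A, Polynomial.C d⁻¹ * B, ?_⟩
  have : (Polynomial.C d⁻¹) * Polynomial.C d = (1 : F[X]) := by
    rw [← C_mul, inv_mul_cancel₀ hd0, C_1]
  calc P = (Polynomial.C d⁻¹ * Polynomial.C d) ^ 2 * P := by rw [this]; ring
    _ = (Polynomial.C d⁻¹) ^ 2 * N := by rw [hQ, C_mul]; ring
    _ = _ := by rw [hNdef]; ring

/-- An irreducible polynomial which is not a norm divides `A² + T·B²` only if it divides both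
`A` and `B`. -/
theorem dvd_of_dvd_sq_add (h2 : (2 : F) ≠ 0) {P A B : F[X]} (hP : Irreducible P)
    (hm : P.Monic) (hn : ¬ IsNormForm P) (hd : P ∣ A ^ 2 + X * B ^ 2) : P ∣ A ∧ P ∣ B := by
  have hB : P ∣ B := by
    by_contra hB
    obtain ⟨U, V, hUV⟩ := (hP.coprime_iff_not_dvd).2 hB
    refine hn (IsNormForm.of_dvd (C := A * V) hP hm ?_ h2)
    have e : (A * V) ^ 2 + X = (A ^ 2 + X * B ^ 2) * V ^ 2 + P * (X * U * (1 + V * B)) := by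
      linear_combination (-X * (1 + V * B)) * hUV
    rw [e]
    exact dvd_add (hd.mul_right _) (dvd_mul_right _ _)
  refine ⟨hP.prime.dvd_of_dvd_pow (n := 2) ?_, hB⟩
  exact (dvd_add_left ((dvd_pow hB two_ne_zero).mul_left X)).1 hd

end Splitting

section FiniteField

variable {F : Type*} [Field F] [Fintype F]

/-- In an extension of finite fields, an element whose norm is a square is a square. -/
theorem isSquare_of_isSquare_norm {K : Type*} [Field K] [Finite K] [Algebra F K]
    (hF : ringChar F ≠ 2) {x : K} (hx : IsSquare (Algebra.norm F x)) : IsSquare x := by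
  classical
  have := Fintype.ofFinite K
  by_cases h0 : x = 0
  · exact h0 ▸ IsSquare.zero
  have hchar : ringChar K = ringChar F := (Algebra.ringChar_eq F K).symm
  rw [FiniteField.isSquare_iff (hchar ▸ hF) h0]
  have hn0 : Algebra.norm F x ≠ 0 := Algebra.norm_ne_zero_iff.2 h0
  rw [FiniteField.isSquare_iff hF hn0] at hx
  have h1 := congrArg (algebraMap F K) hx
  rw [map_pow, FiniteField.algebraMap_norm_eq_pow, map_one, ← pow_mul] at h1
  have hodd := Nat.odd_iff.2 (FiniteField.odd_card_of_char_ne_two hF)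
  have hcard : Fintype.card K = Fintype.card F ^ Module.finrank F K :=
    Module.card_eq_pow_finrank
  have hgeom : (Nat.card K - 1) / (Nat.card F - 1) * (Fintype.card F / 2) = Fintype.card K / 2 := by
    rw [Nat.card_eq_fintype_card, Nat.card_eq_fintype_card]
    obtain ⟨m, hm⟩ := hodd
    have hq : 1 < Fintype.card F := Fintype.one_lt_card
    obtain ⟨t, ht⟩ : Fintype.card F - 1 ∣ Fintype.card K - 1 := by
      rw [hcard]; exact Nat.sub_one_dvd_pow_sub_one _ _
    rw [ht, Nat.mul_div_cancel_left _ (by omega)]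
    have hK : Fintype.card K = 2 * (t * m) + 1 := by
      have : 0 < Fintype.card K := Fintype.card_pos
      have e : (Fintype.card F - 1) * t = 2 * (t * m) := by
        rw [hm, Nat.add_sub_cancel]; ring
      omega
    rw [hK, hm, Nat.mul_add_div two_pos, Nat.mul_add_div two_pos]
    simp
  rwa [hgeom] at h1

theorem isNormForm_iff_isSquare_eval_zero (hF : ringChar F ≠ 2) {P : F[X]} (hP : Irreducible P)
    (hm : P.Monic) : IsNormForm P ↔ IsSquare (P.eval 0) := by
  refine ⟨IsNormForm.isSquare_eval_zero, fun h => ?_⟩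
  have : Fact (Irreducible P) := ⟨hP⟩
  have : Module.Finite F (AdjoinRoot P) := hm.finite_adjoinRoot
  have : Finite (AdjoinRoot P) := Module.finite_of_finite F
  have hnorm : Algebra.norm F (-AdjoinRoot.root P) = P.eval 0 := by
    have h1 := Algebra.PowerBasis.norm_gen_eq_coeff_zero_minpoly (AdjoinRoot.powerBasis' hm)
    rw [AdjoinRoot.powerBasis'_gen, AdjoinRoot.minpoly_root hm.ne_zero, hm.leadingCoeff, inv_one,
      C_1, mul_one, coeff_zero_eq_eval_zero] at h1
    have h3 : (-1 : AdjoinRoot P) = algebraMap F _ (-1) := by simp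
    rw [← neg_one_mul, map_mul, h1, h3, Algebra.norm_algebraMap,
      (AdjoinRoot.powerBasis' hm).finrank, ← mul_assoc, ← mul_pow]
    simp
  obtain ⟨y, hy⟩ := isSquare_of_isSquare_norm hF (hnorm ▸ h : IsSquare (Algebra.norm F (-AdjoinRoot.root P)))
  obtain ⟨C, rfl⟩ := AdjoinRoot.mk_surjective y
  refine IsNormForm.of_dvd (C := C) hP hm ?_ (Ring.two_ne_zero hF)
  rw [← AdjoinRoot.mk_eq_zero, map_add, map_pow, AdjoinRoot.mk_X, sq, ← hy]
  ring

end FiniteField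

section Factorization

variable {F : Type*} [Field F]

theorem finite_monics_of_degree (F : Type*) [Field F] [Finite F] (n : ℕ) :
    {f : F[X] | f.Monic ∧ f.natDegree = n}.Finite :=
  ((monicEquivDegreeLT n).trans (degreeLTEquiv F n).toEquiv).finite_iff.2 inferInstance

/-- The set of monic polynomials of degree `n` over a finite field. -/
noncomputable def monicsOfDegree (F : Type*) [Field F] [Finite F] (n : ℕ) : Finset F[X] :=
  (finite_monics_of_degree F n).toFinset

theorem mem_monicsOfDegree [Finite F] {n : ℕ} {f : F[X]} :
    f ∈ monicsOfDegree F n ↔ f.Monic ∧ f.natDegree = n := by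
  simp [monicsOfDegree]

theorem card_monicsOfDegree [Fintype F] (n : ℕ) :
    (monicsOfDegree F n).card = Fintype.card F ^ n := by
  rw [monicsOfDegree, ← Set.ncard_eq_toFinset_card _ (finite_monics_of_degree F n), ← Nat.card_coe_set_eq]
  exact (Nat.card_congr ((monicEquivDegreeLT n).trans (degreeLTEquiv F n).toEquiv)).trans (by simp)

theorem monicsOfDegree_zero [Finite F] : monicsOfDegree F 0 = {1} := by
  ext f
  simp only [mem_monicsOfDegree, Finset.mem_singleton]
  exact ⟨fun h => (Monic.natDegree_eq_zero h.1).1 h.2, fun h => h ▸ ⟨monic_one, natDegree_one⟩⟩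

open Classical in
/-- The multiplicity of a monic irreducible polynomial `P` in `f`. -/
noncomputable def primeExponent (f P : F[X]) : ℕ := factorization f P

theorem primeExponent_mul {f g : F[X]} (hf : f ≠ 0) (hg : g ≠ 0) (P : F[X]) :
    primeExponent (f * g) P = primeExponent f P + primeExponent g P := by
  classical
  simp [primeExponent, factorization_mul hf hg]

theorem primeExponent_pow (f P : F[X]) (k : ℕ) :
    primeExponent (f ^ k) P = k * primeExponent f P := by
  classical
  simp [primeExponent, factorization_pow]

open Classical in
theorem primeExponent_of_irreducible {P R : F[X]} (hP : Irreducible P) (hm : P.Monic) :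
    primeExponent P R = if R = P then 1 else 0 := by
  rw [primeExponent, factorization_eq_count, normalizedFactors_irreducible hP,
    hm.normalize_eq_self, Multiset.count_singleton]

theorem monic_irreducible_of_primeExponent_ne_zero {f P : F[X]} (h : primeExponent f P ≠ 0) :
    P.Monic ∧ Irreducible P ∧ P ∣ f := by
  classical
  rw [primeExponent, factorization_eq_count, Multiset.count_ne_zero] at h
  have hP := irreducible_of_normalized_factor P h
  refine ⟨?_, hP, dvd_of_mem_normalizedFactors h⟩
  rw [← normalize_normalized_factor P h]
  exact monic_normalize hP.ne_zero

/-- A finite set of monic irreducible polynomials containing all those of degree at most `n`. -/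
structure IsPrimeSet (Q : Finset F[X]) (n : ℕ) : Prop where
  monic : ∀ P ∈ Q, P.Monic
  irreducible : ∀ P ∈ Q, Irreducible P
  mem : ∀ P : F[X], P.Monic → Irreducible P → P.natDegree ≤ n → P ∈ Q

theorem IsPrimeSet.mono {Q : Finset F[X]} {m n : ℕ} (hQ : IsPrimeSet Q n) (h : m ≤ n) :
    IsPrimeSet Q m :=
  ⟨hQ.monic, hQ.irreducible, fun P hP hi hd => hQ.mem P hP hi (hd.trans h)⟩

theorem exists_isPrimeSet [Finite F] (n : ℕ) : ∃ Q : Finset F[X], IsPrimeSet Q n := by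
  classical
  refine ⟨((Finset.range (n + 1)).biUnion (monicsOfDegree F)).filter Irreducible, ?_, ?_, ?_⟩
  · intro P hP
    simp only [Finset.mem_filter, Finset.mem_biUnion, mem_monicsOfDegree] at hP
    obtain ⟨⟨_, _, h, _⟩, _⟩ := hP
    exact h
  · intro P hP
    exact (Finset.mem_filter.1 hP).2
  · intro P hP hi hd
    simp only [Finset.mem_filter, Finset.mem_biUnion, mem_monicsOfDegree, Finset.mem_range]
    exact ⟨⟨_, Nat.lt_succ_of_le hd, hP, rfl⟩, hi⟩

variable {Q : Finset F[X]} {n : ℕ}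

theorem IsPrimeSet.mem_of_primeExponent_ne_zero {f P : F[X]} (hQ : IsPrimeSet Q n)
    (hf : f ≠ 0) (hn : f.natDegree ≤ n) (h : primeExponent f P ≠ 0) : P ∈ Q := by
  obtain ⟨hm, hP, hd⟩ := monic_irreducible_of_primeExponent_ne_zero h
  exact hQ.mem P hm hP ((natDegree_le_of_dvd hd hf).trans hn)

theorem IsPrimeSet.prod_pow_primeExponent {f : F[X]} (hQ : IsPrimeSet Q n) (hf : f.Monic)
    (hn : f.natDegree ≤ n) : ∏ P ∈ Q, P ^ primeExponent f P = f := by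
  classical
  have h := prod_normalizedFactors_eq hf.ne_zero
  rw [hf.normalize_eq_self, Finset.prod_multiset_count_of_subset _ Q] at h
  · simpa only [primeExponent, factorization_eq_count] using h
  · intro P hP
    refine hQ.mem_of_primeExponent_ne_zero hf.ne_zero hn ?_
    rw [primeExponent, factorization_eq_count, Multiset.count_ne_zero]
    exact Multiset.mem_toFinset.1 hP

open Classical in
theorem primeExponent_prod_pow (hm : ∀ P ∈ Q, P.Monic) (hi : ∀ P ∈ Q, Irreducible P)
    (k : F[X] → ℕ) (R : F[X]) :
    primeExponent (∏ P ∈ Q, P ^ k P) R = if R ∈ Q then k R else 0 := by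
  induction Q using Finset.induction_on with
  | empty => simp [primeExponent]
  | insert P s hPs ih =>
    have hmP := hm P (Finset.mem_insert_self P s)
    have hs0 : ∏ P ∈ s, P ^ k P ≠ 0 :=
      (monic_prod_of_monic _ _ fun P hP => (hm P (Finset.mem_insert_of_mem hP)).pow _).ne_zero
    rw [Finset.prod_insert hPs, primeExponent_mul (hmP.pow _).ne_zero hs0, primeExponent_pow,
      primeExponent_of_irreducible (hi P (Finset.mem_insert_self P s)) hmP,
      ih (fun P hP => hm P (Finset.mem_insert_of_mem hP))
        (fun P hP => hi P (Finset.mem_insert_of_mem hP))]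
    by_cases h : R = P
    · subst h; simp [hPs]
    · simp [h]

/-- The local factor `∑ₖ w(k) u^(kd)`. -/
noncomputable def localFactor (d : ℕ) (w : ℕ → ℚ) : PowerSeries ℚ :=
  PowerSeries.mk fun m => if d ∣ m then w (m / d) else 0

/-- The Euler product of a multiplicative function, truncated at a finite set of primes. -/
theorem IsPrimeSet.sum_monicsOfDegree [Finite F] (hQ : IsPrimeSet Q n) (w : F[X] → ℕ → ℚ) :
    ∑ f ∈ monicsOfDegree F n, ∏ P ∈ Q, w P (primeExponent f P) =
      PowerSeries.coeff n (∏ P ∈ Q, localFactor P.natDegree (w P)) := by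
  classical
  have hpos : ∀ P ∈ Q, 0 < P.natDegree := fun P hP => (hQ.irreducible P hP).natDegree_pos
  rw [PowerSeries.coeff_prod]
  let e : F[X] → (F[X] →₀ ℕ) := fun f =>
    Finsupp.onFinset Q (fun P => if P ∈ Q then P.natDegree * primeExponent f P else 0)
      (fun P hP => by by_contra h; simp [h] at hP)
  have he : ∀ f, ∀ P ∈ Q, e f P = P.natDegree * primeExponent f P := by
    intro f P hP
    simp [e, hP]
  refine Finset.sum_of_injOn e ?_ ?_ ?_ ?_
  · intro f hf g hg hfg
    rw [Finset.mem_coe, mem_monicsOfDegree] at hf hg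
    rw [← hQ.prod_pow_primeExponent hf.1 hf.2.le, ← hQ.prod_pow_primeExponent hg.1 hg.2.le]
    refine Finset.prod_congr rfl fun P hP => ?_
    have := DFunLike.congr_fun hfg P
    rw [he f P hP, he g P hP] at this
    rw [Nat.eq_of_mul_eq_mul_left (hpos P hP) this]
  · intro f hf
    rw [Finset.mem_coe, mem_monicsOfDegree] at hf
    rw [Finset.mem_coe, Finset.mem_finsuppAntidiag]
    refine ⟨?_, Finsupp.support_onFinset_subset⟩
    rw [Finset.sum_congr rfl (he f), ← hf.2]
    conv_rhs => rw [← hQ.prod_pow_primeExponent hf.1 hf.2.le]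
    rw [natDegree_prod_of_monic _ _ fun P hP => (hQ.monic P hP).pow _]
    exact Finset.sum_congr rfl fun P _ => by rw [natDegree_pow, mul_comm]
  · intro l hl hle
    rw [Finset.mem_finsuppAntidiag] at hl
    by_contra hne
    have hdvd : ∀ P ∈ Q, P.natDegree ∣ l P := by
      intro P hP
      by_contra h
      refine hne (Finset.prod_eq_zero hP ?_)
      simp [localFactor, h]
    apply hle
    have hexp : ∀ P ∈ Q, primeExponent (∏ P ∈ Q, P ^ (l P / P.natDegree)) P = l P / P.natDegree := by
      intro P hP
      rw [primeExponent_prod_pow hQ.monic hQ.irreducible (fun P => l P / P.natDegree), if_pos hP]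
    refine ⟨∏ P ∈ Q, P ^ (l P / P.natDegree), ?_, ?_⟩
    · rw [Finset.mem_coe, mem_monicsOfDegree]
      refine ⟨monic_prod_of_monic _ _ fun P hP => (hQ.monic P hP).pow _, ?_⟩
      rw [natDegree_prod_of_monic _ _ fun P hP => (hQ.monic P hP).pow _, ← hl.1]
      exact Finset.sum_congr rfl fun P hP => by
        rw [natDegree_pow, Nat.div_mul_cancel (hdvd P hP)]
    · ext P
      by_cases hP : P ∈ Q
      · rw [he _ P hP, hexp P hP, Nat.mul_div_cancel' (hdvd P hP)]
      · have : l P = 0 := by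
          by_contra h
          exact hP (hl.2 (Finsupp.mem_support_iff.2 h))
        simp [e, hP, this]
  · intro f _
    refine Finset.prod_congr rfl fun P hP => ?_
    rw [he f P hP, localFactor, PowerSeries.coeff_mk, if_pos (dvd_mul_right _ _),
      Nat.mul_div_cancel_left _ (hpos P hP)]

end Factorization

section EulerProduct

variable {F : Type*} [Field F] {Q : Finset F[X]} {n : ℕ}

theorem IsNormForm.even_primeExponent (h2 : (2 : F) ≠ 0) {P : F[X]} (hP : Irreducible P)
    (hm : P.Monic) (hn : ¬ IsNormForm P) {f : F[X]} (hf0 : f ≠ 0) (hf : IsNormForm f) :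
    Even (primeExponent f P) := by
  induction hd : f.natDegree using Nat.strong_induction_on generalizing f with
  | _ d ih =>
    by_cases hPf : P ∣ f
    · obtain ⟨A, B, rfl⟩ := hf
      obtain ⟨⟨A, rfl⟩, ⟨B, rfl⟩⟩ := dvd_of_dvd_sq_add h2 hP hm hn hPf
      have e : (P * A) ^ 2 + X * (P * B) ^ 2 = P ^ 2 * (A ^ 2 + X * B ^ 2) := by ring
      rw [e] at hf0 hd ⊢
      have hg0 := right_ne_zero_of_mul hf0
      have hP2 := left_ne_zero_of_mul hf0
      rw [natDegree_mul hP2 hg0, natDegree_pow] at hd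
      have hpos := hP.natDegree_pos
      rw [primeExponent_mul hP2 hg0, primeExponent_pow]
      refine Even.add ((even_two).mul_right _) (ih _ (by omega) hg0 ⟨A, B, rfl⟩ rfl)
    · have : primeExponent f P = 0 := by
        by_contra h
        exact hPf (monic_irreducible_of_primeExponent_ne_zero h).2.2
      simp [this]

variable [Fintype F]

theorem IsPrimeSet.isNormForm_iff (hF : ringChar F ≠ 2) (hQ : IsPrimeSet Q n) {f : F[X]}
    (hf : f.Monic) (hn : f.natDegree ≤ n) :
    IsNormForm f ↔ ∀ P ∈ Q, IsSquare (P.eval 0) ∨ Even (primeExponent f P) := by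
  constructor
  · intro h P hP
    by_cases hs : IsSquare (P.eval 0)
    · exact Or.inl hs
    · have hi := hQ.irreducible P hP
      have hm := hQ.monic P hP
      rw [← isNormForm_iff_isSquare_eval_zero hF hi hm] at hs
      exact Or.inr (h.even_primeExponent (Ring.two_ne_zero hF) hi hm hs hf.ne_zero)
  · intro h
    rw [← hQ.prod_pow_primeExponent hf hn]
    refine IsNormForm.prod fun P hP => ?_
    rcases h P hP with hs | ⟨k, hk⟩
    · exact ((isNormForm_iff_isSquare_eval_zero hF (hQ.irreducible P hP)
        (hQ.monic P hP)).2 hs).pow _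
    · rw [hk, ← two_mul, mul_comm, pow_mul]
      exact IsNormForm.sq _

open Classical in
/-- The number of monic polynomials of degree `n` of the form `A² + T·B²`. -/
noncomputable def normFormCount (F : Type*) [Field F] [Finite F] (n : ℕ) : ℕ :=
  ((monicsOfDegree F n).filter IsNormForm).card

theorem card_eq_normFormCount (n : ℕ) :
    Nat.card {f : F[X] // f.Monic ∧ f.natDegree = n ∧ ∃ A B : F[X], f = A ^ 2 + X * B ^ 2} =
      normFormCount F n := by
  classical
  rw [normFormCount, ← Nat.subtype_card]
  intro f
  simp only [Finset.mem_filter, mem_monicsOfDegree, and_assoc, IsNormForm]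

theorem normFormCount_zero : normFormCount F 0 = 1 := by
  classical
  rw [normFormCount, monicsOfDegree_zero, Finset.filter_singleton, if_pos IsNormForm.one,
    Finset.card_singleton]

open Classical in
/-- The local weight at `P` of the indicator function of norm forms. -/
noncomputable def normWeight (P : F[X]) (k : ℕ) : ℚ :=
  if IsSquare (P.eval 0) ∨ Even k then 1 else 0

open Classical in
/-- The local weight at `P` of the quadratic character `f ↦ χ(f(0))`. -/
noncomputable def charWeight (P : F[X]) (k : ℕ) : ℚ :=
  ((quadraticChar F (P.eval 0) : ℤ) : ℚ) ^ k

theorem IsPrimeSet.coeff_prod_normWeight (hF : ringChar F ≠ 2) (hQ : IsPrimeSet Q n) :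
    PowerSeries.coeff n (∏ P ∈ Q, localFactor P.natDegree (normWeight P)) =
      normFormCount F n := by
  classical
  rw [← hQ.sum_monicsOfDegree, normFormCount, Finset.card_filter, Nat.cast_sum]
  refine Finset.sum_congr rfl fun f hf => ?_
  rw [mem_monicsOfDegree] at hf
  simp only [normWeight]
  rw [Finset.prod_ite_zero]
  simp only [← hQ.isNormForm_iff hF hf.1 hf.2.le, Finset.prod_const_one]
  split_ifs <;> simp

theorem IsPrimeSet.coeff_prod_one (hQ : IsPrimeSet Q n) :
    PowerSeries.coeff n (∏ P ∈ Q, localFactor P.natDegree fun _ => 1) =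
      (Fintype.card F : ℚ) ^ n := by
  rw [← hQ.sum_monicsOfDegree (fun _ _ => 1)]
  simp [card_monicsOfDegree]

theorem sum_quadraticChar_eval_zero [DecidableEq F] (hF : ringChar F ≠ 2) (hn : n ≠ 0) :
    ∑ f ∈ monicsOfDegree F n, quadraticChar F (f.eval 0) = 0 := by
  obtain ⟨c, hc⟩ := quadraticChar_exists_neg_one hF
  have hc0 : c ≠ 0 := by rintro rfl; simp at hc
  let φ : F → F[X] → F[X] := fun a f => f + C ((a - 1) * f.eval 0)
  have heval : ∀ a f, (φ a f).eval 0 = a * f.eval 0 := by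
    intro a f; simp [φ]; ring
  have hmem : ∀ a, ∀ f ∈ monicsOfDegree F n, φ a f ∈ monicsOfDegree F n := by
    intro a f hf
    rw [mem_monicsOfDegree] at hf ⊢
    have hlt : (C ((a - 1) * f.eval 0)).degree < f.degree := by
      refine degree_C_le.trans_lt ?_
      rw [degree_eq_natDegree hf.1.ne_zero, hf.2]
      exact_mod_cast Nat.pos_of_ne_zero hn
    exact ⟨hf.1.add_of_left hlt, by rw [natDegree_add_eq_left_of_degree_lt hlt, hf.2]⟩
  have hinv : ∀ a b : F, a * b = 1 → ∀ f, φ a (φ b f) = f := by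
    intro a b hab f
    have e : (b - 1) * f.eval 0 + (a - 1) * (b * f.eval 0) = 0 := by
      linear_combination (f.eval 0) * hab
    show φ b f + C ((a - 1) * (φ b f).eval 0) = f
    rw [heval]
    show f + C _ + C _ = f
    rw [add_assoc, ← C_add, e, C_0, add_zero]
  have h := Finset.sum_nbij' (s := monicsOfDegree F n) (t := monicsOfDegree F n)
    (f := fun f => -quadraticChar F (f.eval 0)) (g := fun f => quadraticChar F (f.eval 0))
    (φ c) (φ c⁻¹) (hmem c) (hmem c⁻¹)
    (fun f _ => hinv _ _ (inv_mul_cancel₀ hc0) f) (fun f _ => hinv _ _ (mul_inv_cancel₀ hc0) f)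
    (fun f _ => by simp only [heval, map_mul, hc, neg_one_mul])
  rw [Finset.sum_neg_distrib] at h
  omega

theorem IsPrimeSet.coeff_prod_charWeight (hF : ringChar F ≠ 2) (hQ : IsPrimeSet Q n) :
    PowerSeries.coeff n (∏ P ∈ Q, localFactor P.natDegree (charWeight P)) =
      if n = 0 then 1 else 0 := by
  classical
  have h : ∀ f ∈ monicsOfDegree F n, ∏ P ∈ Q, charWeight P (primeExponent f P) =
      ((quadraticChar F (f.eval 0) : ℤ) : ℚ) := by
    intro f hf
    rw [mem_monicsOfDegree] at hf
    conv_rhs => rw [← hQ.prod_pow_primeExponent hf.1 hf.2.le]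
    rw [eval_prod, map_prod, Int.cast_prod]
    refine Finset.prod_congr rfl fun P _ => ?_
    rw [charWeight, eval_pow, map_pow, Int.cast_pow]
  rw [← hQ.sum_monicsOfDegree, Finset.sum_congr rfl h, ← Int.cast_sum]
  split_ifs with hn
  · subst hn
    simp [monicsOfDegree_zero]
  · rw [sum_quadraticChar_eval_zero hF hn, Int.cast_zero]

end EulerProduct

section PowerSeriesIdentities

open PowerSeries (expand coeff)

theorem localFactor_eq_expand {d : ℕ} (hd : d ≠ 0) (w : ℕ → ℚ) :
    localFactor d w = expand d hd (PowerSeries.mk w) := by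
  ext m
  rw [localFactor, PowerSeries.coeff_mk, PowerSeries.coeff_expand, PowerSeries.coeff_mk]

theorem expand_comm {d e : ℕ} (hd : d ≠ 0) (he : e ≠ 0) (f : PowerSeries ℚ) :
    expand d hd (expand e he f) = expand e he (expand d hd f) := by
  rw [← PowerSeries.expand_mul, ← PowerSeries.expand_mul]
  congr 1
  simp only [mul_comm d e]

theorem mk_one_eq_expand :
    (PowerSeries.mk fun _ => (1 : ℚ)) =
      (1 + PowerSeries.X) * expand 2 two_ne_zero (PowerSeries.mk fun _ => (1 : ℚ)) := by
  have h : (PowerSeries.mk fun _ => (1 : ℚ)) * (1 - PowerSeries.X) = 1 :=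
    PowerSeries.mk_one_mul_one_sub_eq_one ℚ
  have h2 := congrArg (expand 2 two_ne_zero) h
  simp only [map_mul, map_sub, map_one, PowerSeries.expand_X] at h2
  set Z := PowerSeries.mk fun _ => (1 : ℚ)
  linear_combination (1 + PowerSeries.X) * expand 2 two_ne_zero Z * h - Z * h2

theorem mk_neg_one_pow_mul :
    (PowerSeries.mk fun k => (-1 : ℚ) ^ k) * (1 + PowerSeries.X) = 1 := by
  ext n
  cases n with
  | zero => simp
  | succ n => simp [mul_add, PowerSeries.coeff_succ_mul_X, pow_succ, PowerSeries.coeff_one]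

theorem mk_even_eq_expand :
    (PowerSeries.mk fun k => if Even k then (1 : ℚ) else 0) =
      expand 2 two_ne_zero (PowerSeries.mk fun _ => (1 : ℚ)) := by
  ext n
  simp [PowerSeries.coeff_expand, even_iff_two_dvd]

variable {F : Type*} [Field F] [Fintype F] {Q : Finset F[X]} {n : ℕ}

/-- The Euler factor at `P` of `N(u)² L(u²) = (1 + u) Z(u) L(u) N(u²)`, where `1 + u` belongs to
the ramified prime `T`. -/
theorem localFactor_identity [DecidableEq F[X]] {P : F[X]} (hP : Irreducible P) (hm : P.Monic) :
    localFactor P.natDegree (normWeight P) ^ 2 *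
        expand 2 two_ne_zero (localFactor P.natDegree (charWeight P)) =
      (if P = X then 1 + PowerSeries.X else 1) * localFactor P.natDegree (fun _ => 1) *
        localFactor P.natDegree (charWeight P) *
        expand 2 two_ne_zero (localFactor P.natDegree (normWeight P)) := by
  classical
  have hd : P.natDegree ≠ 0 := hP.natDegree_pos.ne'
  have h1 := mk_one_eq_expand
  set Z := PowerSeries.mk fun _ => (1 : ℚ) with hZ
  by_cases hX : P = X
  · subst hX
    have hL : PowerSeries.mk (charWeight (X : F[X])) = 1 := by
      ext k
      simp [charWeight, PowerSeries.coeff_one, zero_pow_eq]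
    have hN : PowerSeries.mk (normWeight (X : F[X])) = Z := by
      ext k
      simp [normWeight, hZ]
    simp only [natDegree_X, localFactor_eq_expand one_ne_zero, hL, hN, ← hZ, map_one, if_true,
      PowerSeries.expand_one_apply]
    linear_combination Z * h1
  · have h0 : P.eval 0 ≠ 0 := by
      intro h0
      have hdvd : X ∣ P := by rwa [X_dvd_iff, coeff_zero_eq_eval_zero]
      exact hX (eq_of_monic_of_associated hm monic_X
        ((irreducible_X.associated_of_dvd hP hdvd).symm))
    rw [if_neg hX, one_mul]
    simp only [localFactor_eq_expand hd, expand_comm two_ne_zero hd, ← map_pow, ← map_mul]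
    congr 1
    by_cases hs : IsSquare (P.eval 0)
    · have hL : PowerSeries.mk (charWeight P) = Z := by
        ext k
        simp [charWeight, hZ, (quadraticChar_one_iff_isSquare h0).2 hs]
      have hN : PowerSeries.mk (normWeight P) = Z := by
        ext k
        simp [normWeight, hZ, hs]
      rw [hL, hN, sq]
    · have hL : PowerSeries.mk (charWeight P) = PowerSeries.mk fun k => (-1 : ℚ) ^ k := by
        ext k
        simp [charWeight, quadraticChar_neg_one_iff_not_isSquare.2 hs]
      have hN : PowerSeries.mk (normWeight P) = expand 2 two_ne_zero Z := by
        rw [← mk_even_eq_expand]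
        ext k
        simp [normWeight, hs]
      rw [hL, hN]
      have h3 := mk_neg_one_pow_mul
      set L := PowerSeries.mk fun k => (-1 : ℚ) ^ k
      have h4 := congrArg (expand 2 two_ne_zero) h3
      have h5 := congrArg (expand 2 two_ne_zero) h1
      simp only [map_mul, map_add, map_one, PowerSeries.expand_X] at h4 h5
      rw [← hZ] at *
      set Z2 := expand 2 two_ne_zero Z
      set Z4 := expand 2 two_ne_zero Z2
      set L2 := expand 2 two_ne_zero L
      have h6 : Z * L = Z2 := by linear_combination L * h1 + Z2 * h3
      have h7 : Z2 * L2 = Z4 := by linear_combination L2 * h5 + Z4 * h4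
      rw [h6, ← h7]
      ring

theorem IsPrimeSet.prod_localFactor_identity (hQ : IsPrimeSet Q n)
    (hX : X ∈ Q) :
    (∏ P ∈ Q, localFactor P.natDegree (normWeight P)) ^ 2 *
        expand 2 two_ne_zero (∏ P ∈ Q, localFactor P.natDegree (charWeight P)) =
      (1 + PowerSeries.X) * (∏ P ∈ Q, localFactor P.natDegree fun _ => 1) *
        (∏ P ∈ Q, localFactor P.natDegree (charWeight P)) *
        expand 2 two_ne_zero (∏ P ∈ Q, localFactor P.natDegree (normWeight P)) := by
  classical
  have h := Finset.prod_congr rfl fun P hP =>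
    localFactor_identity (hQ.irreducible P hP) (hQ.monic P hP)
  simp only [Finset.prod_mul_distrib, Finset.prod_pow, ← map_prod, Finset.prod_ite_eq', hX,
    if_true] at h
  exact h

theorem trunc_mul_congr {a b c d : PowerSeries ℚ} (h : PowerSeries.trunc n a = PowerSeries.trunc n b)
    (h' : PowerSeries.trunc n c = PowerSeries.trunc n d) :
    PowerSeries.trunc n (a * c) = PowerSeries.trunc n (b * d) := by
  rw [← PowerSeries.trunc_trunc_mul_trunc, h, h', PowerSeries.trunc_trunc_mul_trunc]

theorem trunc_expand_congr {a b : PowerSeries ℚ}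
    (h : PowerSeries.trunc n a = PowerSeries.trunc n b) :
    PowerSeries.trunc n (expand 2 two_ne_zero a) = PowerSeries.trunc n (expand 2 two_ne_zero b) := by
  ext m
  rw [PowerSeries.coeff_trunc, PowerSeries.coeff_trunc]
  split_ifs with hm
  · rw [PowerSeries.coeff_expand, PowerSeries.coeff_expand]
    split_ifs
    · have := congrArg (fun p => p.coeff (m / 2)) h
      simpa [PowerSeries.coeff_trunc, (Nat.div_le_self m 2).trans_lt hm] using this
    · rfl
  · rfl

/-- The generating function `N(u)` of `normFormCount` satisfies
`(1 - qu) N(u)² = (1 + u) N(u²)`. -/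
theorem mk_normFormCount_sq (hF : ringChar F ≠ 2) :
    (PowerSeries.mk fun n => (normFormCount F n : ℚ)) ^ 2 =
      (1 + PowerSeries.X) * (PowerSeries.mk fun n => (Fintype.card F : ℚ) ^ n) *
        expand 2 two_ne_zero (PowerSeries.mk fun n => (normFormCount F n : ℚ)) := by
  ext n
  obtain ⟨Q, hQ⟩ := exists_isPrimeSet (F := F) (n + 1)
  have hX : X ∈ Q := hQ.mem X monic_X irreducible_X (by simp)
  have key := hQ.prod_localFactor_identity hX
  set N := PowerSeries.mk fun n => (normFormCount F n : ℚ)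
  set Z := PowerSeries.mk fun n => (Fintype.card F : ℚ) ^ n
  have htr : ∀ {f g : PowerSeries ℚ}, (∀ m ≤ n, coeff m f = coeff m g) →
      PowerSeries.trunc (n + 1) f = PowerSeries.trunc (n + 1) g := by
    intro f g h
    ext m
    rw [PowerSeries.coeff_trunc, PowerSeries.coeff_trunc]
    split_ifs with hm
    · exact h m (by omega)
    · rfl
  have hN : PowerSeries.trunc (n + 1) (∏ P ∈ Q, localFactor P.natDegree (normWeight P)) =
      PowerSeries.trunc (n + 1) N :=
    htr fun m hm => by
      rw [(hQ.mono (by omega : m ≤ n + 1)).coeff_prod_normWeight hF, PowerSeries.coeff_mk]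
  have hZ : PowerSeries.trunc (n + 1) (∏ P ∈ Q, localFactor P.natDegree fun _ => 1) =
      PowerSeries.trunc (n + 1) Z :=
    htr fun m hm => by
      rw [(hQ.mono (by omega : m ≤ n + 1)).coeff_prod_one, PowerSeries.coeff_mk]
  have hL : PowerSeries.trunc (n + 1) (∏ P ∈ Q, localFactor P.natDegree (charWeight P)) =
      PowerSeries.trunc (n + 1) 1 :=
    htr fun m hm => by
      rw [(hQ.mono (by omega : m ≤ n + 1)).coeff_prod_charWeight hF, PowerSeries.coeff_one]
  have h := congrArg (PowerSeries.trunc (n + 1)) key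
  rw [sq, trunc_mul_congr (trunc_mul_congr hN hN) (trunc_expand_congr hL),
    trunc_mul_congr (trunc_mul_congr (trunc_mul_congr (b := 1 + PowerSeries.X) rfl hZ) hL)
      (trunc_expand_congr hN), map_one, mul_one, mul_one, ← sq] at h
  have h' := congrArg (fun p => p.coeff n) h
  simpa [PowerSeries.coeff_trunc] using h'

end PowerSeriesIdentities

section CentralBinom

/-- The coefficients of `(1 - u)^(-1/2)`. -/
theorem sum_centralBinom_div_four_pow (n : ℕ) :
    ∑ p ∈ Finset.HasAntidiagonal.antidiagonal n, ((p.1.centralBinom : ℚ) / 4 ^ p.1) *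
      ((p.2.centralBinom : ℚ) / 4 ^ p.2) = 1 := by
  set c : PowerSeries ℚ := PowerSeries.mk fun n => (n.centralBinom : ℚ) / 4 ^ n with hc
  have hode : 2 * (1 - PowerSeries.X) * PowerSeries.derivative ℚ c = c := by
    ext n
    have hrec : ∀ n : ℕ, 2 * ((n : ℚ) + 1) * (((n + 1).centralBinom : ℚ) / 4 ^ (n + 1)) =
        (2 * n + 1) * ((n.centralBinom : ℚ) / 4 ^ n) := by
      intro n
      have := congrArg (Nat.cast (R := ℚ)) (Nat.succ_mul_centralBinom_succ n)
      push_cast at this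
      rw [pow_succ]
      field_simp
      linear_combination 2 * this
    have e : 2 * (1 - PowerSeries.X) * PowerSeries.derivative ℚ c =
        PowerSeries.C 2 * (PowerSeries.derivative ℚ c - PowerSeries.X * PowerSeries.derivative ℚ c) := by
      rw [show (PowerSeries.C (2 : ℚ)) = 2 from map_ofNat _ 2]; ring
    rw [e, PowerSeries.coeff_C_mul, map_sub]
    cases n with
    | zero =>
      have := hrec 0
      simp [PowerSeries.coeff_derivative, hc] at this ⊢
      linarith
    | succ n =>
      have h1 := hrec (n + 1)
      rw [PowerSeries.coeff_succ_X_mul, PowerSeries.coeff_derivative, PowerSeries.coeff_derivative,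
        hc, PowerSeries.coeff_mk, PowerSeries.coeff_mk]
      push_cast at h1 ⊢
      linear_combination h1
  have hsq : c * c * (1 - PowerSeries.X) = 1 := by
    refine PowerSeries.derivative.ext ?_ ?_
    · simp only [Derivation.leibniz, map_sub, Derivation.map_one_eq_zero, smul_eq_mul,
        PowerSeries.derivative_X]
      linear_combination c * hode
    · have h0 : PowerSeries.constantCoeff c = 1 := by
        rw [← PowerSeries.coeff_zero_eq_constantCoeff_apply]
        simp [hc]
      simp [h0]
  have h1 : c * c = PowerSeries.mk 1 := by
    have := PowerSeries.mk_one_mul_one_sub_eq_one ℚ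
    linear_combination (PowerSeries.mk 1) * hsq - (c * c) * this
  have h2 := congrArg (PowerSeries.coeff n) h1
  rw [PowerSeries.coeff_mul] at h2
  simpa [hc] using h2

end CentralBinom

section Recursion

open Finset.HasAntidiagonal (antidiagonal mem_antidiagonal)

/-- The coefficients of `(1 + u)/(1 - xu)`. -/
noncomputable def zetaCoeff (i : ℕ) : ℚ[X] := X ^ i + if i = 0 then 0 else X ^ (i - 1)

theorem natDegree_zetaCoeff_le (i : ℕ) : (zetaCoeff i).natDegree ≤ i := by
  rw [zetaCoeff]
  refine natDegree_add_le_of_degree_le (natDegree_X_pow_le i) ?_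
  split_ifs
  · simp
  · exact (natDegree_X_pow_le _).trans (by omega)

theorem coeff_zetaCoeff (i : ℕ) : (zetaCoeff i).coeff i = 1 := by
  rw [zetaCoeff]
  split_ifs with h
  · simp
  · rw [coeff_add, coeff_X_pow_self, coeff_X_pow, if_neg (by omega), add_zero]

theorem coeff_one_add_X_mul_geom (q : ℚ) (i : ℕ) :
    PowerSeries.coeff i ((1 + PowerSeries.X) * PowerSeries.mk fun n => q ^ n) =
      (zetaCoeff i).eval q := by
  cases i with
  | zero => simp [zetaCoeff]
  | succ i => simp [zetaCoeff, add_mul, PowerSeries.coeff_succ_X_mul]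

theorem sum_antidiagonal_eq_ends_add (g : ℕ × ℕ → ℚ) {n : ℕ} (hn : n ≠ 0) :
    ∑ p ∈ antidiagonal n, g p =
      g (0, n) + g (n, 0) +
        ∑ p ∈ antidiagonal n with p.1 ≠ 0 ∧ p.2 ≠ 0, g p := by
  rw [← Finset.sum_filter_add_sum_filter_not _ (fun p : ℕ × ℕ => p.1 ≠ 0 ∧ p.2 ≠ 0), add_comm]
  congr 1
  have : (antidiagonal n).filter (fun p : ℕ × ℕ => ¬ (p.1 ≠ 0 ∧ p.2 ≠ 0)) =
      {(0, n), (n, 0)} := by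
    ext ⟨i, j⟩
    simp only [Finset.mem_filter, mem_antidiagonal, Finset.mem_insert,
      Finset.mem_singleton, Prod.mk.injEq]
    omega
  rw [this, Finset.sum_pair (by simp [hn.symm])]

theorem two_mul_normFormCount {F : Type*} [Field F] [Fintype F] (hF : ringChar F ≠ 2) {n : ℕ}
    (hn : n ≠ 0) :
    2 * (normFormCount F n : ℚ) =
      ∑ p ∈ antidiagonal n, (zetaCoeff p.1).eval (Fintype.card F : ℚ) *
          (if 2 ∣ p.2 then (normFormCount F (p.2 / 2) : ℚ) else 0) -
        ∑ p ∈ antidiagonal n with p.1 ≠ 0 ∧ p.2 ≠ 0,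
          (normFormCount F p.1 : ℚ) * normFormCount F p.2 := by
  have h := congrArg (PowerSeries.coeff n) (mk_normFormCount_sq hF)
  rw [sq, PowerSeries.coeff_mul, PowerSeries.coeff_mul] at h
  simp only [PowerSeries.coeff_mk, coeff_one_add_X_mul_geom, PowerSeries.coeff_expand] at h
  rw [← h, sum_antidiagonal_eq_ends_add _ hn, normFormCount_zero]
  push_cast
  ring

theorem exists_polynomial_normFormCount (n : ℕ) :
    ∃ P : ℚ[X], P.natDegree ≤ n ∧ P.coeff n = (n.centralBinom : ℚ) / 4 ^ n ∧
      ∀ (F : Type) [Field F] [Fintype F], ringChar F ≠ 2 →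
        (normFormCount F n : ℚ) = P.eval (Fintype.card F : ℚ) := by
  induction n using Nat.strong_induction_on with
  | _ n ih =>
    rcases eq_or_ne n 0 with rfl | hn
    · exact ⟨1, by simp, by simp, fun F _ _ _ => by simp [normFormCount_zero]⟩
    choose! P hdeg hcoeff heval using ih
    set S₁ : ℚ[X] := ∑ p ∈ antidiagonal n,
      zetaCoeff p.1 * (if 2 ∣ p.2 then P (p.2 / 2) else 0) with hS₁
    set S₂ : ℚ[X] := ∑ p ∈ antidiagonal n with p.1 ≠ 0 ∧ p.2 ≠ 0,
      P p.1 * P p.2 with hS₂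
    have hterm : ∀ p ∈ antidiagonal n,
        (zetaCoeff p.1 * (if 2 ∣ p.2 then P (p.2 / 2) else 0)).natDegree ≤ p.1 + p.2 / 2 := by
      intro p hp
      rw [mem_antidiagonal] at hp
      refine natDegree_mul_le_of_le (natDegree_zetaCoeff_le _) ?_
      split_ifs
      · exact hdeg _ (by omega)
      · simp
    have hd₁ : S₁.natDegree ≤ n := by
      refine natDegree_sum_le_of_forall_le _ _ fun p hp => (hterm p hp).trans ?_
      rw [mem_antidiagonal] at hp
      omega
    have hd₂ : S₂.natDegree ≤ n := by
      refine natDegree_sum_le_of_forall_le _ _ fun p hp => ?_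
      rw [Finset.mem_filter, mem_antidiagonal] at hp
      exact (natDegree_mul_le_of_le (hdeg _ (by omega)) (hdeg _ (by omega))).trans hp.1.le
    have hc₁ : S₁.coeff n = 1 := by
      rw [hS₁, finsetSum_coeff, Finset.sum_eq_single (n, 0)]
      · have h0 : (P 0).natDegree ≤ 0 := hdeg 0 (Nat.pos_of_ne_zero hn)
        have := coeff_mul_add_eq_of_natDegree_le (natDegree_zetaCoeff_le n) h0
        rw [add_zero, coeff_zetaCoeff, hcoeff 0 (Nat.pos_of_ne_zero hn)] at this
        simpa using this
      · intro p hp hne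
        refine coeff_eq_zero_of_natDegree_lt ((hterm p hp).trans_lt ?_)
        rw [mem_antidiagonal] at hp
        have : p.2 ≠ 0 := fun h => hne (Prod.ext (by simp; omega) h)
        omega
      · intro h
        simp at h
    have hc₂ : S₂.coeff n = 1 - 2 * ((n.centralBinom : ℚ) / 4 ^ n) := by
      have h := sum_centralBinom_div_four_pow n
      rw [sum_antidiagonal_eq_ends_add _ hn] at h
      have e : S₂.coeff n = ∑ p ∈ antidiagonal n with p.1 ≠ 0 ∧ p.2 ≠ 0,
          ((p.1.centralBinom : ℚ) / 4 ^ p.1) * ((p.2.centralBinom : ℚ) / 4 ^ p.2) := by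
        rw [hS₂, finsetSum_coeff]
        refine Finset.sum_congr rfl fun p hp => ?_
        rw [Finset.mem_filter, mem_antidiagonal] at hp
        have h1 : p.1 < n := by omega
        have h2 : p.2 < n := by omega
        rw [← hcoeff _ h1, ← hcoeff _ h2,
          ← coeff_mul_add_eq_of_natDegree_le (hdeg _ h1) (hdeg _ h2), hp.1]
      rw [e]
      simp only [Nat.centralBinom_zero] at h
      push_cast at h
      linear_combination h
    refine ⟨C (1 / 2) * (S₁ - S₂), ?_, ?_, ?_⟩
    · exact (natDegree_C_mul_le _ _).trans ((natDegree_sub_le_of_le hd₁ hd₂).trans (max_self n).le)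
    · rw [coeff_C_mul, coeff_sub, hc₁, hc₂]
      ring
    · intro F _ _ hF
      have h := two_mul_normFormCount hF hn
      have e₁ : S₁.eval (Fintype.card F : ℚ) =
          ∑ p ∈ antidiagonal n, (zetaCoeff p.1).eval (Fintype.card F : ℚ) *
            (if 2 ∣ p.2 then (normFormCount F (p.2 / 2) : ℚ) else 0) := by
        rw [hS₁, eval_finsetSum]
        refine Finset.sum_congr rfl fun p hp => ?_
        rw [mem_antidiagonal] at hp
        rw [eval_mul]
        split_ifs
        · rw [heval _ (by omega) F hF]
        · simp
      have e₂ : S₂.eval (Fintype.card F : ℚ) =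
          ∑ p ∈ antidiagonal n with p.1 ≠ 0 ∧ p.2 ≠ 0,
            (normFormCount F p.1 : ℚ) * normFormCount F p.2 := by
        rw [hS₂, eval_finsetSum]
        refine Finset.sum_congr rfl fun p hp => ?_
        rw [Finset.mem_filter, mem_antidiagonal] at hp
        rw [eval_mul, heval p.1 (by omega) F hF, heval p.2 (by omega) F hF]
      rw [← e₁, ← e₂] at h
      rw [eval_mul, eval_C, eval_sub]
      linear_combination h / 2

end Recursion

/-- For every `n ≥ 1` there is a polynomial `Pₙ ∈ ℚ[x]` of degree exactly `n` such that
`B(n,q) = Pₙ(q)` for every odd prime power `q`, where `B(n,q)` is the number of monic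
polynomials of degree `n` over the field with `q` elements of the form `A² + T·B²`. -/
theorem B_is_polynomial_in_q (n : ℕ) (hn : 1 ≤ n) :
    ∃ P : Polynomial ℚ, P.degree = n ∧
      ∀ (F : Type) [Field F] [Fintype F], Odd (Fintype.card F) →
        (Nat.card {f : Polynomial F // f.Monic ∧ f.natDegree = n ∧
            ∃ A B : Polynomial F, f = A ^ 2 + Polynomial.X * B ^ 2} : ℚ) =
          P.eval (Fintype.card F : ℚ) := by
  obtain ⟨P, hdeg, hcoeff, hP⟩ := exists_polynomial_normFormCount n
  refine ⟨P, ?_, ?_⟩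
  · refine degree_eq_of_le_of_coeff_ne_zero (degree_le_of_natDegree_le hdeg) ?_
    rw [hcoeff]
    exact div_ne_zero (Nat.cast_ne_zero.2 (Nat.centralBinom_ne_zero n)) (by positivity)
  · intro F _ _ hodd
    rw [card_eq_normFormCount, hP F]
    intro h
    have := FiniteField.even_card_of_char_two h
    rw [Nat.odd_iff] at hodd
    omega
end
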